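/- arXiv:1604.08556 — 13 statements merged into one kernel-verified Lean document; each statement's English description precedes it below -/
import Mathlib

section
/- Let F be a finite field with q elements, let m ≥ 1, let w be a noncommutative polynomial in m variables over F, and for d ≥ 1 and an m-tuple A ∈ M_d(F)^m write T_d(A) for the trace of the evaluation of w at A. For 1 ≤ k ≤ n and λ ∈ F let X_{k,n,λ} be the set of pairs (v, A) with v ∈ F^n and A ∈ M_n(F)^m such that T_n(A) = λ and the smallest F-subspace of F^n containing v and invariant under A_1,…,A_m has dimension k. Then for all 0 < k < n and all λ ∈ F: #X_{k,n,λ} = G(k,n) · q^{m·k·(n−k)} · Σ_{μ ∈ F} #X_{k,k,μ} · #{B ∈ M_{n−k}(F)^m : T_{n−k}(B) = λ − μ}, where G(k,n) denotes the number of k-dimensional F-subspaces of F^n. -/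
open Matrix

/-- The trace of the evaluation of a noncommutative polynomial `w` in `m` variables
at an `m`-tuple of `d × d` matrices. -/
noncomputable def trEval (F : Type) [Field F] (m d : ℕ) (w : FreeAlgebra F (Fin m))
    (A : Fin m → Matrix (Fin d) (Fin d) F) : F :=
  Matrix.trace (FreeAlgebra.lift F A w)

/-- The smallest subspace of `F^d` containing `v` and invariant under `A_1, …, A_m`:
the span of all vectors obtained by applying arbitrary words in the `A i` to `v`. -/
def genSubspace (F : Type) [Field F] (m d : ℕ) (v : Fin d → F)
    (A : Fin m → Matrix (Fin d) (Fin d) F) : Submodule F (Fin d → F) :=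
  Submodule.span F {x | ∃ l : List (Fin m), x = (l.map A).prod.mulVec v}

/-- The set `X_{k,n,λ}` of pairs `(v, A)` with `Tr(w(A)) = λ` and the smallest invariant
subspace containing `v` of dimension `k`. -/
noncomputable def Xkn (F : Type) [Field F] (m : ℕ) (w : FreeAlgebra F (Fin m))
    (k n : ℕ) (lam : F) :
    Set ((Fin n → F) × (Fin m → Matrix (Fin n) (Fin n) F)) :=
  {p | trEval F m n w p.2 = lam ∧ Module.finrank F (genSubspace F m n p.1 p.2) = k}

section BlockTriangular

variable {F : Type} [Field F] {m k l : ℕ}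

/-- Evaluating a noncommutative polynomial at block upper triangular matrices evaluates it
on the diagonal blocks. -/
theorem exists_lift_fromBlocks (B : Fin m → Matrix (Fin k) (Fin k) F)
    (C : Fin m → Matrix (Fin k) (Fin l) F) (D : Fin m → Matrix (Fin l) (Fin l) F)
    (w : FreeAlgebra F (Fin m)) :
    ∃ C' : Matrix (Fin k) (Fin l) F,
      FreeAlgebra.lift F (fun i => fromBlocks (B i) (C i) 0 (D i)) w =
        fromBlocks (FreeAlgebra.lift F B w) C' 0 (FreeAlgebra.lift F D w) := by
  induction w using FreeAlgebra.induction with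
  | grade0 r =>
    refine ⟨0, ?_⟩
    rw [AlgHom.commutes, AlgHom.commutes, AlgHom.commutes]
    simp only [Algebra.algebraMap_eq_smul_one, ← fromBlocks_one, fromBlocks_smul, smul_zero]
  | grade1 i => exact ⟨C i, by simp⟩
  | mul a b ha hb =>
    obtain ⟨Ca, ha⟩ := ha
    obtain ⟨Cb, hb⟩ := hb
    exact ⟨FreeAlgebra.lift F B a * Cb + Ca * FreeAlgebra.lift F D b, by
      simp [map_mul, ha, hb, fromBlocks_multiply]⟩
  | add a b ha hb =>
    obtain ⟨Ca, ha⟩ := ha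
    obtain ⟨Cb, hb⟩ := hb
    exact ⟨Ca + Cb, by simp [map_add, ha, hb, fromBlocks_add]⟩

theorem trace_lift_fromBlocks (B : Fin m → Matrix (Fin k) (Fin k) F)
    (C : Fin m → Matrix (Fin k) (Fin l) F) (D : Fin m → Matrix (Fin l) (Fin l) F)
    (w : FreeAlgebra F (Fin m)) :
    trace (FreeAlgebra.lift F (fun i => fromBlocks (B i) (C i) 0 (D i)) w) =
      trEval F m k w B + trEval F m l w D := by
  obtain ⟨C', h⟩ := exists_lift_fromBlocks B C D w
  simp [h, trace, trEval]

theorem fromBlocks_mulVec_elim_zero (B : Matrix (Fin k) (Fin k) F)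
    (C : Matrix (Fin k) (Fin l) F) (D : Matrix (Fin l) (Fin l) F) (x : Fin k → F) :
    fromBlocks B C 0 D *ᵥ Sum.elim x 0 = Sum.elim (B *ᵥ x) 0 := by
  simp [fromBlocks_mulVec]

end BlockTriangular

section GenSubspace

variable {F : Type} [Field F] {m d : ℕ}

theorem self_mem_genSubspace (v : Fin d → F) (A : Fin m → Matrix (Fin d) (Fin d) F) :
    v ∈ genSubspace F m d v A :=
  Submodule.subset_span ⟨[], by simp⟩

theorem mulVec_mem_genSubspace (v : Fin d → F) (A : Fin m → Matrix (Fin d) (Fin d) F)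
    (i : Fin m) {x : Fin d → F} (hx : x ∈ genSubspace F m d v A) :
    A i *ᵥ x ∈ genSubspace F m d v A := by
  have : genSubspace F m d v A ≤ (genSubspace F m d v A).comap (A i).mulVecLin := by
    refine Submodule.span_le.2 ?_
    rintro _ ⟨l, rfl⟩
    exact Submodule.subset_span ⟨i :: l, by simp [mulVec_mulVec]⟩
  exact this hx

/-- A linear map intertwining two tuples of matrices maps generated subspaces to generated
subspaces. -/
theorem genSubspace_map {k : ℕ} (J : (Fin k → F) →ₗ[F] (Fin d → F))
    (B : Fin m → Matrix (Fin k) (Fin k) F) (A : Fin m → Matrix (Fin d) (Fin d) F)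
    (h : ∀ i x, A i *ᵥ J x = J (B i *ᵥ x)) (x : Fin k → F) :
    genSubspace F m d (J x) A = (genSubspace F m k x B).map J := by
  have hw : ∀ l : List (Fin m), (l.map A).prod *ᵥ J x = J ((l.map B).prod *ᵥ x) := by
    intro l
    induction l with
    | nil => simp
    | cons i l ih => simp [← mulVec_mulVec, ih, h]
  rw [genSubspace, genSubspace, Submodule.map_span]
  congr 1
  ext y
  constructor
  · rintro ⟨l, rfl⟩
    exact ⟨_, ⟨l, rfl⟩, (hw l).symm⟩
  · rintro ⟨_, ⟨l, rfl⟩, rfl⟩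
    exact ⟨l, (hw l).symm⟩

end GenSubspace

section ChangeOfBasis

variable {F : Type} [Field F] {k l n : ℕ}

/-- The algebra isomorphism of matrix algebras induced by a linear isomorphism of the
underlying spaces. -/
noncomputable def matrixConj (e : (Fin k ⊕ Fin l → F) ≃ₗ[F] (Fin n → F)) :
    Matrix (Fin k ⊕ Fin l) (Fin k ⊕ Fin l) F ≃ₐ[F] Matrix (Fin n) (Fin n) F :=
  (toLinAlgEquiv'.trans (e.conjAlgEquiv F)).trans LinearMap.toMatrixAlgEquiv'

theorem matrixConj_mulVec (e : (Fin k ⊕ Fin l → F) ≃ₗ[F] (Fin n → F))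
    (M : Matrix (Fin k ⊕ Fin l) (Fin k ⊕ Fin l) F) (x : Fin k ⊕ Fin l → F) :
    matrixConj e M *ᵥ e x = e (M *ᵥ x) := by
  rw [← toLinAlgEquiv'_apply, matrixConj]
  simp [LinearEquiv.conjAlgEquiv_apply]

theorem trace_matrixConj (e : (Fin k ⊕ Fin l → F) ≃ₗ[F] (Fin n → F))
    (M : Matrix (Fin k ⊕ Fin l) (Fin k ⊕ Fin l) F) :
    trace (matrixConj e M) = trace M := by
  have h := LinearMap.trace_conj' (toLin' M) e
  rw [LinearMap.trace_eq_matrix_trace F (Pi.basisFun F _), Matrix.trace_toLin'_eq] at h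
  exact h

theorem trEval_matrixConj {m : ℕ} (e : (Fin k ⊕ Fin l → F) ≃ₗ[F] (Fin n → F))
    (M : Fin m → Matrix (Fin k ⊕ Fin l) (Fin k ⊕ Fin l) F) (w : FreeAlgebra F (Fin m)) :
    trEval F m n w (fun i => matrixConj e (M i)) = trace (FreeAlgebra.lift F M w) := by
  have : FreeAlgebra.lift F (fun i => matrixConj e (M i)) =
      (matrixConj e).toAlgHom.comp (FreeAlgebra.lift F M) := by
    ext i
    simp
  rw [trEval, this, ← trace_matrixConj e]
  rfl

/-- A `k`-dimensional subspace of `F^n` is the image of the first coordinates under a suitable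
change of basis. -/
theorem exists_linearEquiv_mem_iff (S : Submodule F (Fin n → F))
    (hS : Module.finrank F S = k) (hl : k + l = n) :
    ∃ e : (Fin k ⊕ Fin l → F) ≃ₗ[F] (Fin n → F), ∀ x y, e (Sum.elim x y) ∈ S ↔ y = 0 := by
  obtain ⟨T, hT⟩ := S.exists_isCompl
  have hTl : Module.finrank F T = l := by
    have := Submodule.finrank_add_eq_of_isCompl hT
    simp at this
    omega
  let eS : (Fin k → F) ≃ₗ[F] S := LinearEquiv.ofFinrankEq _ _ (by simp [hS])
  let eT : (Fin l → F) ≃ₗ[F] T := LinearEquiv.ofFinrankEq _ _ (by simp [hTl])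
  refine ⟨(LinearEquiv.sumArrowLequivProdArrow _ _ F F).trans
    ((eS.prodCongr eT).trans (Submodule.prodEquivOfIsCompl S T hT)), fun x y => ?_⟩
  have : (LinearEquiv.sumArrowLequivProdArrow (Fin k) (Fin l) F F) (Sum.elim x y) = (x, y) := rfl
  rw [LinearEquiv.trans_apply, this, LinearEquiv.trans_apply, LinearEquiv.prodCongr_apply,
    Submodule.coe_prodEquivOfIsCompl', S.add_mem_iff_right (eS x).2]
  constructor
  · intro h
    have h0 := (Submodule.disjoint_def.1 hT.disjoint) _ h (eT y).2
    simpa using h0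
  · rintro rfl
    simp

end ChangeOfBasis

section Fibre

variable {F : Type} [Field F] {m k l n : ℕ}

/-- The embedding of `F^k` given by the first block of coordinates. -/
noncomputable def blockInl (e : (Fin k ⊕ Fin l → F) ≃ₗ[F] (Fin n → F)) :
    (Fin k → F) →ₗ[F] (Fin n → F) :=
  e.toLinearMap ∘ₗ (LinearEquiv.sumArrowLequivProdArrow _ _ F F).symm.toLinearMap ∘ₗ
    LinearMap.inl F _ _

theorem blockInl_apply (e : (Fin k ⊕ Fin l → F) ≃ₗ[F] (Fin n → F)) (x : Fin k → F) :
    blockInl e x = e (Sum.elim x 0) := rfl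

theorem blockInl_injective (e : (Fin k ⊕ Fin l → F) ≃ₗ[F] (Fin n → F)) :
    Function.Injective (blockInl e) := by
  intro x y h
  exact funext fun i => congrFun (e.injective h) (Sum.inl i)

theorem range_blockInl (e : (Fin k ⊕ Fin l → F) ≃ₗ[F] (Fin n → F))
    {S : Submodule F (Fin n → F)} (he : ∀ x y, e (Sum.elim x y) ∈ S ↔ y = 0) :
    LinearMap.range (blockInl e) = S := by
  ext z
  constructor
  · rintro ⟨x, rfl⟩
    exact (he x 0).2 rfl
  · intro hz
    have hx := Sum.elim_comp_inl_inr (e.symm z)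
    refine ⟨e.symm z ∘ Sum.inl, ?_⟩
    have h0 : e.symm z ∘ Sum.inr = 0 :=
      (he (e.symm z ∘ Sum.inl) _).1 (by rw [hx]; simpa using hz)
    rw [blockInl_apply, ← h0, hx, e.apply_symm_apply]

theorem genSubspace_blockInl (e : (Fin k ⊕ Fin l → F) ≃ₗ[F] (Fin n → F))
    (B : Fin m → Matrix (Fin k) (Fin k) F)
    (C : Fin m → Matrix (Fin k) (Fin l) F) (D : Fin m → Matrix (Fin l) (Fin l) F)
    (x : Fin k → F) :
    genSubspace F m n (blockInl e x)
        (fun i => matrixConj e (fromBlocks (B i) (C i) 0 (D i))) =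
      (genSubspace F m k x B).map (blockInl e) := by
  refine genSubspace_map _ _ _ (fun i y => ?_) x
  rw [blockInl_apply, blockInl_apply, matrixConj_mulVec, fromBlocks_mulVec_elim_zero]

theorem finrank_genSubspace_eq_iff (x : Fin k → F) (B : Fin m → Matrix (Fin k) (Fin k) F) :
    Module.finrank F (genSubspace F m k x B) = k ↔ genSubspace F m k x B = ⊤ := by
  constructor
  · intro h
    exact Submodule.eq_top_of_finrank_eq (by simpa using h)
  · intro h
    rw [h]
    simp

/-- If the subspace generated by `v` is the span of the first block of coordinates, then `v` lies
in it and the matrices are block upper triangular. -/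
theorem exists_blocks_of_genSubspace_eq (e : (Fin k ⊕ Fin l → F) ≃ₗ[F] (Fin n → F))
    {S : Submodule F (Fin n → F)} (he : ∀ x y, e (Sum.elim x y) ∈ S ↔ y = 0)
    (v : Fin n → F) (A : Fin m → Matrix (Fin n) (Fin n) F) (h : genSubspace F m n v A = S) :
    ∃ (x : Fin k → F) (B : Fin m → Matrix (Fin k) (Fin k) F)
      (C : Fin m → Matrix (Fin k) (Fin l) F) (D : Fin m → Matrix (Fin l) (Fin l) F),
      v = blockInl e x ∧ A = fun i => matrixConj e (fromBlocks (B i) (C i) 0 (D i)) := by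
  have hv : v ∈ LinearMap.range (blockInl e) := by
    rw [range_blockInl e he, ← h]
    exact self_mem_genSubspace v A
  obtain ⟨x, rfl⟩ := hv
  let M := fun i => (matrixConj e).symm (A i)
  refine ⟨x, fun i => (M i).toBlocks₁₁, fun i => (M i).toBlocks₁₂, fun i => (M i).toBlocks₂₂,
    rfl, ?_⟩
  funext i
  have h21 : (M i).toBlocks₂₁ = 0 := by
    have hz : ∀ y, (M i).toBlocks₂₁ *ᵥ y = 0 := by
      intro y
      have hy : blockInl e y ∈ genSubspace F m n (blockInl e x) A := by
        rw [h, ← range_blockInl e he]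
        exact ⟨y, rfl⟩
      have hA := mulVec_mem_genSubspace _ _ i hy
      have hAM : A i = matrixConj e (M i) := by simp [M]
      rw [h, blockInl_apply, hAM, matrixConj_mulVec, ← fromBlocks_toBlocks (M i),
        fromBlocks_mulVec, he] at hA
      simpa using hA
    exact Matrix.ext_of_mulVec_single fun j => by rw [hz, zero_mulVec]
  rw [← h21, fromBlocks_toBlocks]
  simp [M]

theorem card_genSubspace_eq [Fintype F] (w : FreeAlgebra F (Fin m)) (hl : k + l = n) (lam : F)
    (S : Submodule F (Fin n → F)) (hS : Module.finrank F S = k) :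
    Nat.card {p : (Fin n → F) × (Fin m → Matrix (Fin n) (Fin n) F) //
        trEval F m n w p.2 = lam ∧ genSubspace F m n p.1 p.2 = S} =
      Fintype.card F ^ (m * k * l) *
        ∑ μ : F, Nat.card (Xkn F m w k k μ) *
          Nat.card {D : Fin m → Matrix (Fin l) (Fin l) F // trEval F m l w D = lam - μ} := by
  obtain ⟨e, he⟩ := exists_linearEquiv_mem_iff S hS hl
  let Q := (Fin m → Matrix (Fin k) (Fin l) F) × Σ μ : F, Xkn F m w k k μ ×
      {D : Fin m → Matrix (Fin l) (Fin l) F // trEval F m l w D = lam - μ}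
  let f : Q → {p : (Fin n → F) × (Fin m → Matrix (Fin n) (Fin n) F) //
        trEval F m n w p.2 = lam ∧ genSubspace F m n p.1 p.2 = S} := fun q =>
    ⟨(blockInl e q.2.2.1.1.1, fun i =>
        matrixConj e (fromBlocks (q.2.2.1.1.2 i) (q.1 i) 0 (q.2.2.2.1 i))), by
      obtain ⟨C, μ, ⟨⟨x, B⟩, hB, hx⟩, D, hD⟩ := q
      dsimp only at hB hx ⊢
      rw [trEval_matrixConj, trace_lift_fromBlocks, hB, hD, genSubspace_blockInl,
        (finrank_genSubspace_eq_iff x B).1 hx, Submodule.map_top, range_blockInl e he]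
      simp⟩
  have hf : Function.Bijective f := by
    constructor
    · rintro ⟨C, μ, ⟨⟨x, B⟩, hB, hx⟩, D, hD⟩ ⟨C', μ', ⟨⟨x', B'⟩, hB', hx'⟩, D', hD'⟩ h
      have h' := Prod.ext_iff.1 (Subtype.ext_iff.1 h)
      obtain rfl : x = x' := blockInl_injective e h'.1
      have hM := fun i => fromBlocks_inj.1 ((matrixConj e).injective (congrFun h'.2 i))
      obtain rfl : B = B' := funext fun i => (hM i).1
      obtain rfl : C = C' := funext fun i => (hM i).2.1
      obtain rfl : D = D' := funext fun i => (hM i).2.2.2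
      obtain rfl : μ = μ' := hB.symm.trans hB'
      rfl
    · rintro ⟨⟨v, A⟩, hA, hS⟩
      obtain ⟨x, B, C, D, rfl, rfl⟩ := exists_blocks_of_genSubspace_eq e he v A hS
      dsimp only at hA hS
      rw [trEval_matrixConj, trace_lift_fromBlocks] at hA
      rw [genSubspace_blockInl, ← range_blockInl e he, ← Submodule.map_top] at hS
      have hx := Submodule.map_injective_of_injective (blockInl_injective e) hS
      exact ⟨⟨C, trEval F m k w B, ⟨(x, B), rfl, (finrank_genSubspace_eq_iff x B).2 hx⟩,
        D, eq_sub_of_add_eq' hA⟩, rfl⟩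
  rw [← Nat.card_congr (Equiv.ofBijective f hf), Nat.card_prod, Nat.card_sigma]
  congr 1
  · simp only [Matrix, Nat.card_eq_fintype_card, Fintype.card_fun, Fintype.card_fin, ← pow_mul]
    congr 1
    ring
  · exact Finset.sum_congr rfl fun μ _ => Nat.card_prod _ _

end Fibre

/-- the stratification count
`#X_{k,n,λ} = G(k,n) · q^{mk(n−k)} · Σ_{μ∈F} #X_{k,k,μ} · #{B : Tr(w(B)) = λ − μ}`. -/
theorem card_Xkn_stratification
    (F : Type) [Field F] [Fintype F] (m : ℕ) (hm : 1 ≤ m)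
    (w : FreeAlgebra F (Fin m)) (k n : ℕ) (hk : 0 < k) (hkn : k < n) (lam : F) :
    Nat.card (Xkn F m w k n lam) =
      Nat.card {S : Submodule F (Fin n → F) // Module.finrank F S = k} *
        (Fintype.card F) ^ (m * k * (n - k)) *
        ∑ μ : F,
          Nat.card (Xkn F m w k k μ) *
            Nat.card {Bb : Fin m → Matrix (Fin (n - k)) (Fin (n - k)) F //
              trEval F m (n - k) w Bb = lam - μ} := by
  let g : Xkn F m w k n lam → {S : Submodule F (Fin n → F) // Module.finrank F S = k} :=
    fun p => ⟨genSubspace F m n p.1.1 p.1.2, p.2.2⟩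
  have fibre : ∀ S, Nat.card {p // g p = S} =
      Fintype.card F ^ (m * k * (n - k)) * ∑ μ : F, Nat.card (Xkn F m w k k μ) *
        Nat.card {Bb : Fin m → Matrix (Fin (n - k)) (Fin (n - k)) F //
          trEval F m (n - k) w Bb = lam - μ} := by
    rintro ⟨S, hS⟩
    rw [← card_genSubspace_eq w (Nat.add_sub_of_le hkn.le) lam S hS]
    exact Nat.card_congr
      { toFun := fun p => ⟨p.1.1, p.1.2.1, congrArg Subtype.val p.2⟩
        invFun := fun p => ⟨⟨p.1, p.2.1, by rw [p.2.2, hS]⟩, Subtype.ext p.2.2⟩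
        left_inv := fun _ => rfl
        right_inv := fun _ => rfl }
  have := Fintype.ofFinite {S : Submodule F (Fin n → F) // Module.finrank F S = k}
  rw [← Nat.card_congr (Equiv.sigmaFiberEquiv g), Nat.card_sigma,
    Finset.sum_congr rfl fun S _ => fibre S, Finset.sum_const, Finset.card_univ,
    Nat.card_eq_fintype_card, smul_eq_mul, ← mul_assoc]
end

section
/- Let F be a finite field with q elements, let n ≥ 1, let S be a finite set, and let g : S → M_n(F) be any function. Then #{(X,s) ∈ M_n(F) × S : trace(X · g(s)) = 0} − #{(X,s) ∈ M_n(F) × S : trace(X · g(s)) = 1} = q^{n²} · #{s ∈ S : g(s) = 0}. -/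
namespace Matrix

theorem exists_trace_mul_eq_one {m K : Type*} [Fintype m] [Field K]
    {A : Matrix m m K} (hA : A ≠ 0) : ∃ Y : Matrix m m K, trace (Y * A) = 1 := by
  obtain ⟨Y, hY⟩ : ∃ Y : Matrix m m K, trace (Y * A) ≠ 0 := by
    by_contra! h
    exact hA (ext_iff_trace_mul_left.mpr fun Y => by simpa using h Y)
  exact ⟨(trace (Y * A))⁻¹ • Y, by simp [hY]⟩

/-- Translation by a matrix `Y` with `trace (Y * A) = 1` matches the two fibres. -/
theorem card_trace_mul_eq_zero_eq_card_trace_mul_eq_one {m K : Type*} [Fintype m] [Field K]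
    {A : Matrix m m K} (hA : A ≠ 0) :
    Nat.card {X : Matrix m m K // trace (X * A) = 0} =
      Nat.card {X : Matrix m m K // trace (X * A) = 1} := by
  obtain ⟨Y, hY⟩ := exists_trace_mul_eq_one hA
  exact Nat.card_congr ((Equiv.addRight Y).subtypeEquiv fun X => by
    simp [add_mul, trace_add, hY])

theorem card_trace_mul_eq_zero_sub_card_trace_mul_eq_one {K : Type*} [Field K] [Fintype K] {n : ℕ}
    [DecidableEq (Matrix (Fin n) (Fin n) K)] (A : Matrix (Fin n) (Fin n) K) :
    (Nat.card {X : Matrix (Fin n) (Fin n) K // trace (X * A) = 0} : ℤ) -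
        (Nat.card {X : Matrix (Fin n) (Fin n) K // trace (X * A) = 1} : ℤ) =
      if A = 0 then (Fintype.card K : ℤ) ^ (n ^ 2) else 0 := by
  split_ifs with hA
  · subst hA
    have h : Fintype.card (Matrix (Fin n) (Fin n) K) = Fintype.card K ^ (n ^ 2) := by
      rw [← Nat.card_eq_fintype_card, Matrix, Nat.card_fun, Nat.card_fun]
      simp [← pow_mul, sq]
    simp [h]
  · rw [card_trace_mul_eq_zero_eq_card_trace_mul_eq_one hA, sub_self]

end Matrix

theorem Nat.card_subtype_prod_eq_sum {α β : Type*} [Finite α] [Fintype β] (P : α × β → Prop) :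
    Nat.card {p : α × β // P p} = ∑ b, Nat.card {a : α // P (a, b)} := by
  rw [← Nat.card_sigma]
  exact Nat.card_congr
    { toFun := fun p => ⟨p.1.2, p.1.1, p.2⟩
      invFun := fun p => ⟨(p.2.1, p.1), p.2.2⟩
      left_inv := fun _ => rfl
      right_inv := fun _ => rfl }

/-- finite-field dimensional reduction. For any function `g` from a finite
set `S` to `n × n` matrices over a finite field `F` with `q` elements,
`#{(X,s) : Tr(X·g(s)) = 0} − #{(X,s) : Tr(X·g(s)) = 1} = q^{n²}·#{s : g(s) = 0}`. -/
theorem dimensional_reduction_count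
    (F : Type) [Field F] [Fintype F] (n : ℕ) (hn : 1 ≤ n)
    (S : Type) [Fintype S] (g : S → Matrix (Fin n) (Fin n) F) :
    (Nat.card {p : Matrix (Fin n) (Fin n) F × S // Matrix.trace (p.1 * g p.2) = 0} : ℤ) -
        (Nat.card {p : Matrix (Fin n) (Fin n) F × S // Matrix.trace (p.1 * g p.2) = 1} : ℤ) =
      (Fintype.card F : ℤ) ^ (n ^ 2) * (Nat.card {s : S // g s = 0} : ℤ) := by
  classical
  simp only [Nat.card_subtype_prod_eq_sum, Nat.cast_sum]
  rw [← Finset.sum_sub_distrib]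
  simp only [Matrix.card_trace_mul_eq_zero_sub_card_trace_mul_eq_one]
  rw [← Finset.sum_filter, Finset.sum_const, nsmul_eq_mul, mul_comm, Nat.card_eq_fintype_card,
    Fintype.card_subtype]
end

section
/- Let F be a finite field with q elements of odd characteristic. Then the number of pairs (X,Y) of 2×2 matrices over F satisfying XY + YX = 0 equals q^5 + 3q^4 − 2q^3 − 2q^2 + q. -/
namespace QuantumPlane

variable {F : Type*} [Field F]

/-- The polarization of `x ^ 2 + y * z`, i.e. the anticommutator on trace-zero matrices
`!![x, y; z, -x]`. -/
def polar (u : F × F × F) : Module.Dual F (F × F × F) :=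
  (2 * u.1) • LinearMap.fst F F (F × F) +
    (u.2.2 • LinearMap.fst F F F + u.2.1 • LinearMap.snd F F F) ∘ₗ LinearMap.snd F F (F × F)

lemma polar_apply (u v : F × F × F) :
    polar u v = 2 * u.1 * v.1 + (u.2.2 * v.2.1 + u.2.1 * v.2.2) := by
  simp [polar]

lemma polar_eq_zero_iff (h2 : (2 : F) ≠ 0) {u : F × F × F} : polar u = 0 ↔ u = 0 := by
  refine ⟨fun h ↦ ?_, fun h ↦ LinearMap.ext fun v ↦ by simp [h, polar_apply]⟩
  have h₁ := LinearMap.congr_fun h (1, 0, 0)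
  have h₂ := LinearMap.congr_fun h (0, 1, 0)
  have h₃ := LinearMap.congr_fun h (0, 0, 1)
  simp only [polar_apply, LinearMap.zero_apply] at h₁ h₂ h₃
  ext <;> simp_all

/-- The splitting of a `2 × 2` matrix into its scalar part and its trace-zero part. -/
def matrixEquiv (h2 : (2 : F) ≠ 0) : Matrix (Fin 2) (Fin 2) F ≃ F × F × F × F where
  toFun X := ((X 0 0 + X 1 1) / 2, (X 0 0 - X 1 1) / 2, X 0 1, X 1 0)
  invFun p := !![p.1 + p.2.1, p.2.2.1; p.2.2.2, p.1 - p.2.1]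
  left_inv X := by
    ext i j
    fin_cases i <;> fin_cases j <;> simp <;> field_simp <;> ring
  right_inv p := by
    ext <;> simp <;> field_simp <;> ring

/-- The anticommutation relation in terms of scalar and trace-zero parts. -/
def Anticommute (a b : F) (u v : F × F × F) : Prop :=
  a • v + b • u = 0 ∧ 2 * a * b + polar u v = 0

lemma mul_add_mul_eq_zero_iff (h2 : (2 : F) ≠ 0) (p q : F × F × F × F) :
    (matrixEquiv h2).symm p * (matrixEquiv h2).symm q +
      (matrixEquiv h2).symm q * (matrixEquiv h2).symm p = 0 ↔
    Anticommute p.1 q.1 p.2 q.2 := by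
  obtain ⟨a, x, y, z⟩ := p
  obtain ⟨b, x', y', z'⟩ := q
  simp only [matrixEquiv, Equiv.coe_fn_symm_mk, Anticommute, polar_apply, ← Matrix.ext_iff,
    Fin.forall_fin_two, Matrix.add_apply, Matrix.mul_apply, Fin.sum_univ_two, Matrix.of_apply,
    Matrix.cons_val_zero, Matrix.cons_val_one, Matrix.cons_val', Matrix.cons_val_fin_one,
    Matrix.zero_apply, Prod.ext_iff, Prod.fst_add, Prod.snd_add, Prod.smul_fst, Prod.smul_snd,
    smul_eq_mul, Prod.fst_zero, Prod.snd_zero]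
  constructor
  · rintro ⟨⟨h₁, h₂⟩, h₃, h₄⟩
    refine ⟨⟨mul_left_cancel₀ (mul_ne_zero h2 h2) ?_, mul_left_cancel₀ h2 ?_,
      mul_left_cancel₀ h2 ?_⟩, mul_left_cancel₀ h2 ?_⟩
    · linear_combination h₁ - h₄
    · linear_combination h₂
    · linear_combination h₃
    · linear_combination h₁ + h₄
  · rintro ⟨⟨h₁, h₂, h₃⟩, h₄⟩
    refine ⟨⟨?_, ?_⟩, ?_, ?_⟩
    · linear_combination h₄ + 2 * h₁
    · linear_combination 2 * h₂
    · linear_combination 2 * h₃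
    · linear_combination h₄ - 2 * h₁

variable [Fintype F]

lemma card_ker_dual (f : Module.Dual F (F × F × F)) (hf : f ≠ 0) :
    Nat.card {v // f v = 0} = Fintype.card F ^ 2 := by
  have h := Module.Dual.finrank_ker_add_one_of_ne_zero hf
  simp only [Module.finrank_prod, Module.finrank_self] at h
  have hk : Module.finrank F (LinearMap.ker f) = 2 := by omega
  have := Module.natCard_eq_pow_finrank (K := F) (V := LinearMap.ker f)
  rw [hk, Nat.card_eq_fintype_card (α := F)] at this
  exact this

lemma card_polar_eq_zero (h2 : (2 : F) ≠ 0) :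
    (Nat.card {w : (F × F × F) × (F × F × F) // polar w.1 w.2 = 0} : ℤ) =
      (Fintype.card F : ℤ) ^ 5 + (Fintype.card F : ℤ) ^ 3 - (Fintype.card F : ℤ) ^ 2 := by
  classical
  have hfib (u : F × F × F) : (Nat.card {v // polar u v = 0} : ℤ) = (Fintype.card F : ℤ) ^ 2 +
      if u = 0 then (Fintype.card F : ℤ) ^ 3 - (Fintype.card F : ℤ) ^ 2 else 0 := by
    split_ifs with hu
    · rw [(polar_eq_zero_iff h2).2 hu]
      simp
      ring
    · rw [card_ker_dual _ (mt (polar_eq_zero_iff h2).1 hu), Nat.cast_pow, add_zero]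
  rw [Nat.card_congr (Equiv.subtypeProdEquivSigmaSubtype fun u v ↦ polar u v = 0),
    Nat.card_sigma, Nat.cast_sum, Finset.sum_congr rfl fun u _ ↦ hfib u]
  simp [Finset.sum_add_distrib]
  ring

lemma card_sq_add_mul_eq_sq (h2 : (2 : F) ≠ 0) {c : F} (hc : c ≠ 0) :
    (Nat.card {u : F × F × F // u.1 ^ 2 + u.2.1 * u.2.2 = c ^ 2} : ℤ) =
      (Fintype.card F : ℤ) ^ 2 + Fintype.card F := by
  classical
  have hcc : c ≠ -c := fun h ↦ (mul_ne_zero h2 hc) (by linear_combination h)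
  have hfib (x y : F) : ((Finset.univ.filter fun z ↦ x ^ 2 + y * z = c ^ 2).card : ℤ) =
      1 + if y = 0 then ((if x = c then (Fintype.card F : ℤ) else 0) +
        (if x = -c then (Fintype.card F : ℤ) else 0) - 1) else 0 := by
    split_ifs with hy hx hx' hx'
    · exact absurd (hx.symm.trans hx') hcc
    · simp [hy, hx]
    · simp [hy, hx']
    · have : x ^ 2 ≠ c ^ 2 := by simp [sq_eq_sq_iff_eq_or_eq_neg, *]
      simp [hy, this]
    · have : (Finset.univ.filter fun z ↦ x ^ 2 + y * z = c ^ 2) = {(c ^ 2 - x ^ 2) / y} := by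
        ext z
        simp only [Finset.mem_filter, Finset.mem_univ, true_and, Finset.mem_singleton,
          eq_div_iff hy]
        constructor <;> intro h <;> linear_combination h
      simp [this]
  rw [Nat.card_eq_fintype_card, Fintype.card_subtype, Finset.card_filter]
  simp only [Fintype.sum_prod_type]
  simp only [← Finset.card_filter, Nat.cast_sum, hfib]
  simp [Finset.sum_add_distrib, Finset.sum_sub_distrib]
  ring

lemma card_anticommute (h2 : (2 : F) ≠ 0) [DecidableEq F] (a b : F) :
    (Nat.card {w : (F × F × F) × (F × F × F) // Anticommute a b w.1 w.2} : ℤ) =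
      if a = 0 then
        if b = 0 then
          (Fintype.card F : ℤ) ^ 5 + (Fintype.card F : ℤ) ^ 3 - (Fintype.card F : ℤ) ^ 2
        else (Fintype.card F : ℤ) ^ 3
      else if b = 0 then (Fintype.card F : ℤ) ^ 3
      else (Fintype.card F : ℤ) ^ 2 + Fintype.card F := by
  have hV : Nat.card (F × F × F) = Fintype.card F ^ 3 := by
    simp
    ring
  split_ifs with ha hb hb
  · simpa [Anticommute, ha, hb] using card_polar_eq_zero h2
  · rw [← Nat.cast_pow, ← hV, Nat.cast_inj]
    refine Nat.card_congr ⟨fun w ↦ w.1.2, fun v ↦ ⟨(0, v), ?_⟩, ?_, fun v ↦ rfl⟩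
    · simp [Anticommute, ha, polar_apply]
    · rintro ⟨⟨u, v⟩, h, -⟩
      have hu : u = 0 := by simpa [ha, hb] using h
      simp [hu]
  · rw [← Nat.cast_pow, ← hV, Nat.cast_inj]
    refine Nat.card_congr ⟨fun w ↦ w.1.1, fun u ↦ ⟨(u, 0), ?_⟩, ?_, fun u ↦ rfl⟩
    · simp [Anticommute, hb]
    · rintro ⟨⟨u, v⟩, h, -⟩
      have hv : v = 0 := by simpa [ha, hb] using h
      simp [hv]
  · rw [← card_sq_add_mul_eq_sq h2 ha, Nat.cast_inj]
    have hv {u v : F × F × F} (h : a • v + b • u = 0) : v = (-(b / a)) • u := by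
      rw [← inv_smul_smul₀ ha v, eq_neg_of_add_eq_zero_left h, smul_neg, smul_smul, neg_smul,
        div_eq_inv_mul]
    have key (u : F × F × F) : 2 * a * b + polar u ((-(b / a)) • u) =
        2 * (b / a) * (a ^ 2 - (u.1 ^ 2 + u.2.1 * u.2.2)) := by
      rw [map_smul, polar_apply, smul_eq_mul]
      field_simp
      ring
    have hba : 2 * (b / a) ≠ 0 := mul_ne_zero h2 (div_ne_zero hb ha)
    refine Nat.card_congr ⟨fun w ↦ ⟨w.1.1, ?_⟩, fun u ↦ ⟨(u.1, (-(b / a)) • u.1), ?_, ?_⟩, ?_,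
      fun u ↦ rfl⟩
    · obtain ⟨⟨u, v⟩, h, h'⟩ := w
      rw [hv h, key, mul_eq_zero, or_iff_right hba, sub_eq_zero] at h'
      exact h'.symm
    · rw [smul_smul, ← add_smul, mul_neg, mul_div_cancel₀ _ ha, neg_add_cancel, zero_smul]
    · rw [key, u.2, sub_self, mul_zero]
    · rintro ⟨⟨u, v⟩, h, h'⟩
      exact Subtype.ext (Prod.ext rfl (hv h).symm)

/-- Anticommuting pairs of matrices, grouped by their scalar parts. -/
def anticommutingEquiv (h2 : (2 : F) ≠ 0) :
    {p : Matrix (Fin 2) (Fin 2) F × Matrix (Fin 2) (Fin 2) F // p.1 * p.2 + p.2 * p.1 = 0} ≃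
      Σ c : F × F, {w : (F × F × F) × (F × F × F) // Anticommute c.1 c.2 w.1 w.2} :=
  ((((matrixEquiv h2).prodCongr (matrixEquiv h2)).trans
    (Equiv.prodProdProdComm F (F × F × F) F (F × F × F))).subtypeEquiv fun p ↦ by
      simpa using mul_add_mul_eq_zero_iff h2 (matrixEquiv h2 p.1) (matrixEquiv h2 p.2)).trans
  (Equiv.subtypeProdEquivSigmaSubtype
    fun (c : F × F) (w : (F × F × F) × (F × F × F)) ↦ Anticommute c.1 c.2 w.1 w.2)

end QuantumPlane

/-- over a finite field `F` with `q` elements of odd characteristic, the number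
of pairs of 2×2 matrices `(X,Y)` with `XY + YX = 0` equals `q^5 + 3q^4 − 2q^3 − 2q^2 + q`. -/
theorem card_rep_two_quantum_plane
    (F : Type) [Field F] [Fintype F] (hchar : ringChar F ≠ 2) :
    (Nat.card {p : Matrix (Fin 2) (Fin 2) F × Matrix (Fin 2) (Fin 2) F //
        p.1 * p.2 + p.2 * p.1 = 0} : ℤ) =
      (Fintype.card F : ℤ) ^ 5 + 3 * (Fintype.card F : ℤ) ^ 4
        - 2 * (Fintype.card F : ℤ) ^ 3 - 2 * (Fintype.card F : ℤ) ^ 2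
        + (Fintype.card F : ℤ) := by
  classical
  have h2 : (2 : F) ≠ 0 := Ring.two_ne_zero hchar
  have hsum (A B : ℤ) :
      ∑ b : F, (if b = 0 then A else B) = A + (Fintype.card F - 1) * B := by
    rw [← Finset.add_sum_erase _ _ (Finset.mem_univ 0), if_pos rfl,
      Finset.sum_congr rfl fun b hb ↦ if_neg (Finset.ne_of_mem_erase hb)]
    simp [Nat.cast_sub Fintype.card_pos]
  rw [Nat.card_congr (QuantumPlane.anticommutingEquiv h2), Nat.card_sigma, Nat.cast_sum,
    Finset.sum_congr rfl fun c _ ↦ QuantumPlane.card_anticommute h2 c.1 c.2,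
    Fintype.sum_prod_type]
  simp only [Finset.sum_ite_irrel, hsum]
  ring
end

section
/- Let F be a finite field with q elements of odd characteristic. Then the number of tuples (n,p,r,s,t,v,x,z) ∈ F^8 satisfying 2rvz + pv + rt + nt + ps = 1 equals q^7 − 2q^4 + q^3. -/
/-- A parametrization of the cell by solving for `s` when `p ≠ 0`, for `n` when `p = 0` and
`t ≠ 0`, and for `z` when `p = t = 0`. -/
def cell3Param (F : Type) [Field F] :
    (Fˣ × F × F × F × F × F × F) ⊕ (Fˣ × F × F × F × F × F) ⊕ (Fˣ × Fˣ × F × F × F) →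
      F × F × F × F × F × F × F × F
  | .inl (p, n, r, t, v, x, z) =>
    (n, p, r, (1 - 2 * r * v * z - p * v - r * t - n * t) / p, t, v, x, z)
  | .inr (.inl (t, r, s, v, x, z)) =>
    ((1 - 2 * r * v * z - r * t) / t, 0, r, s, t, v, x, z)
  | .inr (.inr (r, v, n, s, x)) => (n, 0, r, s, 0, v, x, 1 / (2 * r * v))

theorem cell3Param_injective (F : Type) [Field F] : Function.Injective (cell3Param F) := by
  rintro (⟨p, n, r, t, v, x, z⟩ | ⟨t, r, s, v, x, z⟩ | ⟨r, v, n, s, x⟩)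
    (⟨p', n', r', t', v', x', z'⟩ | ⟨t', r', s', v', x', z'⟩ | ⟨r', v', n', s', x'⟩) h <;>
  simp [cell3Param, Units.val_inj, @eq_comm F 0] at h ⊢ <;> simp [h]

theorem mem_range_cell3Param {F : Type} [Field F] (h2 : (2 : F) ≠ 0) (n p r s t v x z : F) :
    (n, p, r, s, t, v, x, z) ∈ Set.range (cell3Param F) ↔
      2 * r * v * z + p * v + r * t + n * t + p * s = 1 := by
  simp only [Set.mem_range]
  constructor
  · rintro ⟨⟨p, n, r, t, v, x, z⟩ | ⟨t, r, s, v, x, z⟩ | ⟨r, v, n, s, x⟩, h⟩ <;>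
      simp only [cell3Param, Prod.mk.injEq] at h <;>
      obtain ⟨rfl, rfl, rfl, rfl, rfl, rfl, rfl, rfl⟩ := h
    · have := p.ne_zero
      field_simp
      ring
    · have := t.ne_zero
      field_simp
      ring
    · have := r.ne_zero
      have := v.ne_zero
      field_simp
      ring
  · intro h
    by_cases hp : p = 0
    · subst hp
      by_cases ht : t = 0
      · subst ht
        have hr : r ≠ 0 := by rintro rfl; simp at h
        have hv : v ≠ 0 := by rintro rfl; simp at h
        refine ⟨.inr (.inr (Units.mk0 r hr, Units.mk0 v hv, n, s, x)), ?_⟩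
        simp only [cell3Param, Units.val_mk0, Prod.mk.injEq, true_and]
        rw [div_eq_iff (by simp [h2, hr, hv])]
        linear_combination -h
      · refine ⟨.inr (.inl (Units.mk0 t ht, r, s, v, x, z)), ?_⟩
        simp only [cell3Param, Units.val_mk0, Prod.mk.injEq, and_true]
        rw [div_eq_iff ht]
        linear_combination -h
    · refine ⟨.inl (Units.mk0 p hp, n, r, t, v, x, z), ?_⟩
      simp only [cell3Param, Units.val_mk0, Prod.mk.injEq, and_true, true_and]
      rw [div_eq_iff hp]
      linear_combination -h


/-- over a finite field `F` with `q` elements of odd characteristic, the number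
of tuples `(n,p,r,s,t,v,x,z) ∈ F^8` with `2rvz + pv + rt + nt + ps = 1` (the cell `S₃` of the
Brauer–Severi scheme of quantum affine 3-space at `q = −1`) equals `q^7 − 2q^4 + q^3`. -/
theorem card_cell3_quantum_affine_space
    (F : Type) [Field F] [Fintype F] (hchar : ringChar F ≠ 2) :
    (Nat.card {(n, p, r, s, t, v, x, z) : F × F × F × F × F × F × F × F |
        2 * r * v * z + p * v + r * t + n * t + p * s = 1} : ℤ) =
      (Fintype.card F : ℤ) ^ 7 - 2 * (Fintype.card F : ℤ) ^ 4 + (Fintype.card F : ℤ) ^ 3 := by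
  classical
  rw [show {(n, p, r, s, t, v, x, z) : F × F × F × F × F × F × F × F |
      2 * r * v * z + p * v + r * t + n * t + p * s = 1} = Set.range (cell3Param F) from
    Set.ext fun ⟨n, p, r, s, t, v, x, z⟩ =>
      (mem_range_cell3Param (Ring.two_ne_zero hchar) n p r s t v x z).symm]
  rw [Nat.card_range_of_injective (cell3Param_injective F)]
  have hq : 1 ≤ Fintype.card F := Fintype.card_pos
  simp only [Nat.card_eq_fintype_card, Fintype.card_sum, Fintype.card_prod, Fintype.card_units]
  push_cast [Nat.cast_sub hq]
  ring
end

section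
/- Let F be a finite field with q elements of odd characteristic. Then the number of tuples (n,p,r,t,v,w,x,y,z) ∈ F^9 satisfying 2rvz + pvy + rty + nty + pz + rx + nx + pw = 1 equals q^8 − 2q^5 + q^4. -/
/-- The hypersurface `2rvz + pvy + rty + nty + pz + rx + nx + pw = 1`. -/
def cell2 (F : Type*) [Field F] : Set (F × F × F × F × F × F × F × F × F) :=
  {(n, p, r, t, v, w, x, y, z) : F × F × F × F × F × F × F × F × F |
    2 * r * v * z + p * v * y + r * t * y + n * t * y + p * z + r * x + n * x + p * w = 1}

/-- Parametrization of `cell2 F` on the strata `p ≠ 0` (solve for `w`), `p = 0 ≠ r + n`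
(solve for `x`) and `p = r + n = 0` (solve for `z`). -/
def cell2Coord {F : Type*} [Field F] :
    (Fˣ × F × F × F × F × F × F × F) ⊕ (Fˣ × F × F × F × F × F × F) ⊕
      (Fˣ × Fˣ × F × F × F × F) → F × F × F × F × F × F × F × F × F
  | .inl (p, n, r, t, v, x, y, z) =>
    (n, p, r, t, v,
      (1 - (2 * r * v * z + p * v * y + r * t * y + n * t * y + p * z + r * x + n * x)) / p,
      x, y, z)
  | .inr (.inl (s, r, t, v, w, y, z)) =>
    (s - r, 0, r, t, v, w, (1 - (2 * r * v * z + s * t * y)) / s, y, z)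
  | .inr (.inr (r, v, t, w, x, y)) => (-r, 0, r, t, v, w, x, y, 1 / (2 * r * v))

theorem cell2Coord_mem {F : Type*} [Field F] (h2 : (2 : F) ≠ 0) (a) :
    cell2Coord (F := F) a ∈ cell2 F := by
  rcases a with ⟨p, n, r, t, v, x, y, z⟩ | ⟨s, r, t, v, w, y, z⟩ | ⟨r, v, t, w, x, y⟩
  · have := p.ne_zero
    simp only [cell2Coord, cell2, Set.mem_ofPred_eq]
    field_simp
    ring
  · have := s.ne_zero
    simp only [cell2Coord, cell2, Set.mem_ofPred_eq]
    field_simp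
    ring
  · have := r.ne_zero
    have := v.ne_zero
    simp only [cell2Coord, cell2, Set.mem_ofPred_eq]
    field_simp
    ring

theorem cell2Coord_injective {F : Type*} [Field F] :
    Function.Injective (cell2Coord (F := F)) := by
  rintro (⟨p, n, r, t, v, x, y, z⟩ | ⟨s, r, t, v, w, y, z⟩ | ⟨r, v, t, w, x, y⟩)
    (⟨p', n', r', t', v', x', y', z'⟩ | ⟨s', r', t', v', w', y', z'⟩ | ⟨r', v', t', w', x', y'⟩) h
  all_goals
    simp only [cell2Coord, Prod.mk.injEq, Units.val_inj, Units.ne_zero, (Units.ne_zero _).symm,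
      false_and, and_false] at h
  · grind
  · obtain ⟨hs, -, rfl, rfl, rfl, rfl, -, rfl, rfl⟩ := h
    rw [sub_left_inj, Units.val_inj] at hs
    rw [hs]
  · obtain ⟨hs, -, rfl, -⟩ := h
    exact absurd (by linear_combination hs) s.ne_zero
  · obtain ⟨hs, -, rfl, -⟩ := h
    exact absurd (by linear_combination -hs) s'.ne_zero
  · grind

theorem exists_cell2Coord_eq {F : Type*} [Field F] {a} (ha : a ∈ cell2 F) :
    ∃ b, cell2Coord b = a := by
  obtain ⟨n, p, r, t, v, w, x, y, z⟩ := a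
  simp only [cell2, Set.mem_ofPred_eq] at ha
  by_cases hp : p = 0
  · subst hp
    by_cases hs : r + n = 0
    · obtain rfl : n = -r := by linear_combination hs
      have hz : 2 * r * v * z = 1 := by linear_combination ha
      have hr : r ≠ 0 := by rintro rfl; simp at hz
      have hv : v ≠ 0 := by rintro rfl; simp at hz
      refine ⟨.inr (.inr (Units.mk0 r hr, Units.mk0 v hv, t, w, x, y)), ?_⟩
      simp only [cell2Coord, Units.val_mk0, Prod.mk.injEq, true_and]
      exact (eq_one_div_of_mul_eq_one_right hz).symm
    · refine ⟨.inr (.inl (Units.mk0 (r + n) hs, r, t, v, w, y, z)), ?_⟩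
      simp only [cell2Coord, Units.val_mk0, Prod.mk.injEq, true_and, and_true]
      refine ⟨by ring, ?_⟩
      rw [div_eq_iff hs]
      linear_combination -ha
  · refine ⟨.inl (Units.mk0 p hp, n, r, t, v, x, y, z), ?_⟩
    simp only [cell2Coord, Units.val_mk0, Prod.mk.injEq, true_and, and_true]
    rw [div_eq_iff hp]
    linear_combination -ha

theorem cell2Coord_bijective {F : Type*} [Field F] (h2 : (2 : F) ≠ 0) :
    Function.Bijective fun a => (⟨cell2Coord a, cell2Coord_mem h2 a⟩ : cell2 F) :=
  ⟨fun _ _ h => cell2Coord_injective (congrArg Subtype.val h),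
    fun a => (exists_cell2Coord_eq a.2).imp fun _ h => Subtype.ext h⟩


/-- over a finite field `F` with `q` elements of odd characteristic, the number
of tuples `(n,p,r,t,v,w,x,y,z) ∈ F^9` with
`2rvz + pvy + rty + nty + pz + rx + nx + pw = 1` (the cell `S₂` of the Brauer–Severi scheme
of quantum affine 3-space at `q = −1`) equals `q^8 − 2q^5 + q^4`. -/
theorem card_cell2_quantum_affine_space
    (F : Type) [Field F] [Fintype F] (hchar : ringChar F ≠ 2) :
    (Nat.card {(n, p, r, t, v, w, x, y, z) : F × F × F × F × F × F × F × F × F |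
        2 * r * v * z + p * v * y + r * t * y + n * t * y + p * z + r * x + n * x + p * w
          = 1} : ℤ) =
      (Fintype.card F : ℤ) ^ 8 - 2 * (Fintype.card F : ℤ) ^ 5 + (Fintype.card F : ℤ) ^ 4 := by
  have h2 : (2 : F) ≠ 0 := Ring.two_ne_zero hchar
  change (Nat.card (cell2 F) : ℤ) = _
  rw [← Nat.card_congr (Equiv.ofBijective _ (cell2Coord_bijective h2))]
  have hq : 1 ≤ Fintype.card F := Fintype.card_pos
  simp only [Nat.card_sum, Nat.card_prod, Nat.card_units]
  simp only [Nat.card_eq_fintype_card]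
  push_cast [Nat.cast_sub hq]
  ring
end

section
/- Let F be a finite field with q elements of odd characteristic. Then the number of tuples (p,r,s,t,u,v,w,x,y,z) ∈ F^{10} satisfying 2rvz + puz + pvy + rty + psy + rux + puw + tz + vx + sx + tw = 1 equals q^9 − q^6 − 2q^5 + 3q^4 − q^3. -/
theorem LinearMap.card_fiber_mul_card {F V : Type*} [Field F] [Finite F] [AddCommGroup V]
    [Module F V] [Finite V] {f : V →ₗ[F] F} (hf : f ≠ 0) (c : F) :
    Nat.card {v // f v = c} * Nat.card F = Nat.card V := by
  have hs : Function.Surjective f := LinearMap.surjective hf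
  have hfib (d : F) : Nat.card {v // f v = d} = Nat.card {v // f v = c} := by
    obtain ⟨a, ha⟩ := hs (c - d)
    refine Nat.card_congr ((Equiv.addRight a).subtypeEquiv fun v ↦ ?_)
    simp only [Equiv.coe_addRight, map_add, ha]
    grind
  have := Fintype.ofFinite F
  rw [← Nat.card_congr (Equiv.sigmaFiberEquiv f), Nat.card_sigma,
    Finset.sum_congr rfl fun d _ ↦ hfib d]
  simp [mul_comm]

section

variable {F : Type*} [Field F] [Fintype F]

theorem card_linear_eq_one (a b c d : F) [Decidable (a = 0 ∧ b = 0 ∧ c = 0 ∧ d = 0)] :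
    Nat.card {x : F × F × F × F // a * x.1 + b * x.2.1 + c * x.2.2.1 + d * x.2.2.2 = 1} =
      if a = 0 ∧ b = 0 ∧ c = 0 ∧ d = 0 then 0 else Fintype.card F ^ 3 := by
  split_ifs with h
  · obtain ⟨rfl, rfl, rfl, rfl⟩ := h
    simp
  · let f : F × F × F × F →ₗ[F] F :=
      (a • LinearMap.id).coprod <| (b • LinearMap.id).coprod <|
        (c • LinearMap.id).coprod (d • LinearMap.id)
    have hfx (x : F × F × F × F) :
        f x = a * x.1 + b * x.2.1 + c * x.2.2.1 + d * x.2.2.2 := by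
      simp [f, add_assoc]
    have hf : f ≠ 0 := by
      intro h0
      refine h ⟨?_, ?_, ?_, ?_⟩
      · simpa [h0] using (hfx (1, 0, 0, 0)).symm
      · simpa [h0] using (hfx (0, 1, 0, 0)).symm
      · simpa [h0] using (hfx (0, 0, 1, 0)).symm
      · simpa [h0] using (hfx (0, 0, 0, 1)).symm
    have key := f.card_fiber_mul_card hf 1
    simp only [hfx, Nat.card_prod, Nat.card_eq_fintype_card (α := F)] at key
    refine Nat.eq_of_mul_eq_mul_right (Fintype.card_pos (α := F)) (key.trans ?_)
    ring

theorem sum_ite_eq_zero [DecidableEq F] (a b : ℤ) :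
    ∑ x : F, (if x = 0 then a else b) = a + (Fintype.card F - 1) * b := by
  rw [← Finset.add_sum_erase _ _ (Finset.mem_univ (0 : F)),
    Finset.sum_congr rfl fun x hx ↦ if_neg (Finset.ne_of_mem_erase hx)]
  simp [Nat.cast_sub (Fintype.card_pos (α := F))]

theorem card_mul_eq_zero_pairs :
    (Nat.card {x : F × F × F × F // x.1 * x.2.1 = 0 ∧ x.1 * (x.2.2.1 * x.2.2.2) = 0} : ℤ) =
      (Fintype.card F : ℤ) ^ 3 + 2 * (Fintype.card F : ℤ) ^ 2 - 3 * Fintype.card F + 1 := by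
  classical
  have hr (r : F) : ∑ x : F × F × F,
      (if r * x.1 = 0 ∧ r * (x.2.1 * x.2.2) = 0 then (1 : ℤ) else 0) =
      if r = 0 then (Fintype.card F : ℤ) ^ 3 else 2 * Fintype.card F - 1 := by
    split_ifs with h
    · simp [h]
      ring
    · have hp (p : F) : ∑ u : F, (if p = 0 ∨ u = 0 then (1 : ℤ) else 0) =
          if p = 0 then (Fintype.card F : ℤ) else 1 := by
        split_ifs with h0 <;> simp [h0]
      simp only [h, mul_eq_zero, false_or, ite_and, Fintype.sum_prod_type, Finset.sum_ite_irrel,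
        Finset.sum_const_zero, hp, sum_ite_eq_zero]
      ring
  rw [Nat.card_eq_fintype_card, Fintype.card_subtype,
    Finset.natCast_card_filter, Fintype.sum_prod_type]
  simp only [hr, sum_ite_eq_zero]
  ring

/-- Number of points `(p, r, s, t, u, v)` at which the coefficients of `w, x, y, z` in the cell equation all vanish. -/
theorem card_coeff_eq_zero (h2 : (2 : F) ≠ 0) :
    (Nat.card {a : F × F × F × F × F × F //
        a.1 * a.2.2.2.2.1 + a.2.2.2.1 = 0 ∧ a.2.1 * a.2.2.2.2.1 + a.2.2.2.2.2 + a.2.2.1 = 0 ∧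
          a.1 * a.2.2.2.2.2 + a.2.1 * a.2.2.2.1 + a.1 * a.2.2.1 = 0 ∧
          2 * a.2.1 * a.2.2.2.2.2 + a.1 * a.2.2.2.2.1 + a.2.2.2.1 = 0} : ℤ) =
      (Fintype.card F : ℤ) ^ 3 + 2 * (Fintype.card F : ℤ) ^ 2 - 3 * Fintype.card F + 1 := by
  rw [← card_mul_eq_zero_pairs, Nat.cast_inj]
  refine Nat.card_congr ⟨fun ⟨(p, r, s, t, u, v), h⟩ ↦ ⟨(r, v, p, u), ?_⟩,
    fun ⟨(r, v, p, u), h⟩ ↦ ⟨(p, r, -(r * u) - v, -(p * u), u, v), ?_⟩, ?_, ?_⟩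
  · obtain ⟨h₁, h₂, h₃, h₄⟩ := h
    dsimp only at h₁ h₂ h₃ h₄
    exact ⟨mul_left_cancel₀ h2 (by linear_combination h₄ - h₁),
      mul_left_cancel₀ h2 (by linear_combination r * h₁ + p * h₂ - h₃)⟩
  · obtain ⟨h₁, h₂⟩ := h
    dsimp only at h₁ h₂
    refine ⟨by ring, by ring, ?_, ?_⟩
    · linear_combination -2 * h₂
    · linear_combination 2 * h₁
  · rintro ⟨⟨p, r, s, t, u, v⟩, h₁, h₂, -⟩
    dsimp only at h₁ h₂
    simp only [Subtype.mk.injEq, Prod.mk.injEq, true_and, and_true]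
    exact ⟨by linear_combination -h₂, by linear_combination -h₁⟩
  · rintro ⟨⟨r, v, p, u⟩, h⟩
    rfl

end


/-- over a finite field `F` with `q` elements of odd characteristic, the number
of tuples `(p,r,s,t,u,v,w,x,y,z) ∈ F^10` with
`2rvz + puz + pvy + rty + psy + rux + puw + tz + vx + sx + tw = 1` (the cell `S₁` of the
Brauer–Severi scheme of quantum affine 3-space at `q = −1`) equals
`q^9 − q^6 − 2q^5 + 3q^4 − q^3`. -/
theorem card_cell1_quantum_affine_space
    (F : Type) [Field F] [Fintype F] (hchar : ringChar F ≠ 2) :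
    (Nat.card {(p, r, s, t, u, v, w, x, y, z) : F × F × F × F × F × F × F × F × F × F |
        2 * r * v * z + p * u * z + p * v * y + r * t * y + p * s * y + r * u * x
          + p * u * w + t * z + v * x + s * x + t * w = 1} : ℤ) =
      (Fintype.card F : ℤ) ^ 9 - (Fintype.card F : ℤ) ^ 6 - 2 * (Fintype.card F : ℤ) ^ 5
        + 3 * (Fintype.card F : ℤ) ^ 4 - (Fintype.card F : ℤ) ^ 3 := by
  classical
  have h2 : (2 : F) ≠ 0 := Ring.two_ne_zero hchar
  let e : {(p, r, s, t, u, v, w, x, y, z) : F × F × F × F × F × F × F × F × F × F |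
        2 * r * v * z + p * u * z + p * v * y + r * t * y + p * s * y + r * u * x
          + p * u * w + t * z + v * x + s * x + t * w = 1} ≃
      Σ a : F × F × F × F × F × F, {b : F × F × F × F //
        (a.1 * a.2.2.2.2.1 + a.2.2.2.1) * b.1
          + (a.2.1 * a.2.2.2.2.1 + a.2.2.2.2.2 + a.2.2.1) * b.2.1
          + (a.1 * a.2.2.2.2.2 + a.2.1 * a.2.2.2.1 + a.1 * a.2.2.1) * b.2.2.1
          + (2 * a.2.1 * a.2.2.2.2.2 + a.1 * a.2.2.2.2.1 + a.2.2.2.1) * b.2.2.2 = 1} :=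
    { toFun := fun ⟨(p, r, s, t, u, v, w, x, y, z), h⟩ ↦
        ⟨(p, r, s, t, u, v), (w, x, y, z), by
          simp only [Set.mem_ofPred_eq] at h ⊢
          linear_combination h⟩
      invFun := fun ⟨(p, r, s, t, u, v), (w, x, y, z), h⟩ ↦
        ⟨(p, r, s, t, u, v, w, x, y, z), by
          simp only [Set.mem_ofPred_eq] at h ⊢
          linear_combination h⟩
      left_inv := fun _ ↦ rfl
      right_inv := fun _ ↦ rfl }
  have hN := card_coeff_eq_zero h2
  rw [Nat.card_eq_fintype_card, Fintype.card_subtype] at hN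
  rw [Nat.card_congr e, Nat.card_sigma, Finset.sum_congr rfl fun a _ ↦ card_linear_eq_one ..,
    Finset.sum_ite, Finset.sum_const_zero, zero_add, Finset.sum_const, smul_eq_mul,
    ← Finset.compl_filter, Finset.card_compl, Nat.cast_mul,
    Nat.cast_sub (Finset.card_le_univ _), hN]
  simp only [Fintype.card_prod]
  push_cast
  ring
end

section
/- Let F be a finite field with q elements of odd characteristic. Then the number of triples (X,Y,Z) of 2×2 matrices over F with trace(XYZ + XZY) = 1 equals q^{11} − q^8 − 3q^7 + 2q^6 + 2q^5 − q^4, and the number of triples with trace(XYZ + XZY) = 0 equals q^{11} + q^9 + 2q^8 − 5q^7 + 3q^5 − q^4. In particular the difference of the two counts equals q^4·(q^5 + 3q^4 − 2q^3 − 2q^2 + q). -/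
open Finset in
/-- A nonzero linear functional on a finite vector space takes every value equally often. -/
theorem card_mul_sum_fiber_of_ne_zero {F V : Type*} [Field F] [Fintype F] [DecidableEq F]
    [AddCommGroup V] [Module F V] [Fintype V] (f : V →ₗ[F] F) (hf : f ≠ 0) (k : F) :
    (Fintype.card F : ℤ) * ∑ v, (if f v = k then 1 else 0) = Fintype.card V := by
  have hsurj : Function.Surjective f := LinearMap.surjective hf
  have key : ∀ l : F, (∑ v, (if f v = l then 1 else 0) : ℤ) = ∑ v, (if f v = k then 1 else 0) := by
    intro l
    obtain ⟨u, hu⟩ := hsurj (l - k)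
    refine (Fintype.sum_equiv (Equiv.addRight u) _ _ fun v => ?_).symm
    simp only [Equiv.coe_addRight, map_add, hu]
    exact if_congr ⟨fun h => by rw [h]; abel, fun h => by linear_combination h⟩ rfl rfl
  calc (Fintype.card F : ℤ) * ∑ v, (if f v = k then 1 else 0)
      = ∑ l : F, ∑ v, (if f v = l then 1 else 0) := by
        rw [sum_congr rfl fun l _ => key l]; simp
    _ = Fintype.card V := by rw [sum_comm]; simp

/-- The split quadric `a² + bc = s²`, with `s ≠ 0`, has `q² + q` points. -/
theorem sum_split_quadric {F : Type*} [Field F] [Fintype F] [DecidableEq F] (h2 : (2 : F) ≠ 0)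
    {s : F} (hs : s ≠ 0) :
    (∑ a : F, ∑ b : F, ∑ c : F, (if a * a + b * c = s * s then 1 else 0) : ℤ) =
      (Fintype.card F : ℤ) ^ 2 + Fintype.card F := by
  have inner : ∀ a b : F, (∑ c : F, (if a * a + b * c = s * s then 1 else 0) : ℤ) =
      1 + if b = 0 then
        (if a = s then (Fintype.card F : ℤ) else 0) + (if a = -s then (Fintype.card F : ℤ) else 0) - 1
      else 0 := by
    intro a b
    by_cases hb : b = 0
    · subst hb
      by_cases h1 : a = s
      · have : ¬ a = -s := fun h => mul_ne_zero h2 hs (by linear_combination h - h1)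
        rw [if_neg this]
        simp [h1]
      · by_cases h3 : a = -s
        · rw [if_neg h1]
          simp [h3]
        · have : a * a ≠ s * s := fun h => by
            rcases mul_self_eq_mul_self_iff.1 h with h | h <;> contradiction
          simp [h1, h3, this]
    · have : ∀ c, (a * a + b * c = s * s) ↔ c = (s * s - a * a) / b := by
        intro c
        rw [eq_div_iff hb]
        constructor <;> intro h <;> linear_combination h
      simp [this, hb]
  simp only [inner, Finset.sum_add_distrib, Finset.sum_sub_distrib, Finset.sum_ite_eq',
    Finset.mem_univ, if_true]
  simp
  ring

/-- The matrix with half trace `x.1` and traceless part given by `x.2`. -/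
def halfTraceMatrix {F : Type*} [Field F] (x : F × F × F × F) : Matrix (Fin 2) (Fin 2) F :=
  !![x.1 + x.2.1, x.2.2.1; x.2.2.2, x.1 - x.2.1]

theorem halfTraceMatrix_bijective {F : Type*} [Field F] (h2 : (2 : F) ≠ 0) :
    Function.Bijective (halfTraceMatrix (F := F)) := by
  constructor
  · rintro ⟨a, b, c, d⟩ ⟨a', b', c', d'⟩ h
    simp only [halfTraceMatrix] at h
    have h00 := congrFun₂ h 0 0
    have h01 := congrFun₂ h 0 1
    have h10 := congrFun₂ h 1 0
    have h11 := congrFun₂ h 1 1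
    simp at h00 h01 h10 h11
    have ha : a = a' := mul_left_cancel₀ h2 (by linear_combination h00 + h11)
    have hb : b = b' := mul_left_cancel₀ h2 (by linear_combination h00 - h11)
    simp [*]
  · intro M
    refine ⟨((M 0 0 + M 1 1) / 2, (M 0 0 - M 1 1) / 2, M 0 1, M 1 0), ?_⟩
    ext i j
    fin_cases i <;> fin_cases j <;> simp [halfTraceMatrix] <;> field_simp <;> ring

theorem halfTraceMatrix_anticommute_iff {F : Type*} [Field F] (h2 : (2 : F) ≠ 0)
    (x a b c y d e f : F) :
    halfTraceMatrix (x, a, b, c) * halfTraceMatrix (y, d, e, f) +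
        halfTraceMatrix (y, d, e, f) * halfTraceMatrix (x, a, b, c) = 0 ↔
      2 * (x * y) + (2 * a * d + b * f + c * e) = 0 ∧ x * d + y * a = 0 ∧
        x * e + y * b = 0 ∧ x * f + y * c = 0 := by
  rw [← Matrix.ext_iff]
  simp [Fin.forall_fin_two, halfTraceMatrix]
  constructor
  · rintro ⟨⟨h00, h01⟩, h10, h11⟩
    refine ⟨mul_left_cancel₀ h2 ?_, mul_left_cancel₀ (mul_ne_zero h2 h2) ?_,
      mul_left_cancel₀ h2 ?_, mul_left_cancel₀ h2 ?_⟩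
    · linear_combination h00 + h11
    · linear_combination h00 - h11
    · linear_combination h01
    · linear_combination h10
  · rintro ⟨h, h1, h3, h4⟩
    refine ⟨⟨?_, ?_⟩, ?_, ?_⟩
    · linear_combination h + 2 * h1
    · linear_combination 2 * h3
    · linear_combination 2 * h4
    · linear_combination h - 2 * h1

/-- The number of anticommuting pairs with prescribed half traces `x` and `y`. -/
theorem sum_anticommute_fixed_halfTrace {F : Type*} [Field F] [Fintype F] [DecidableEq F]
    (h2 : (2 : F) ≠ 0) (x y : F) :
    (∑ v : F × F × F, ∑ w : F × F × F,
      (if 2 * (x * y) + (2 * v.1 * w.1 + v.2.1 * w.2.2 + v.2.2 * w.2.1) = 0 ∧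
          x * w.1 + y * v.1 = 0 ∧ x * w.2.1 + y * v.2.1 = 0 ∧ x * w.2.2 + y * v.2.2 = 0
        then 1 else 0) : ℤ) =
      if x = 0 then
        if y = 0 then (Fintype.card F : ℤ) ^ 5 + (Fintype.card F : ℤ) ^ 3 - (Fintype.card F : ℤ) ^ 2
        else (Fintype.card F : ℤ) ^ 3
      else
        if y = 0 then (Fintype.card F : ℤ) ^ 3
        else (Fintype.card F : ℤ) ^ 2 + Fintype.card F := by
  have hq : (Fintype.card F : ℤ) ≠ 0 := by simp
  by_cases hx : x = 0
  · subst hx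
    by_cases hy : y = 0
    · subst hy
      have inner : ∀ v : F × F × F, (∑ w : F × F × F,
          (if 2 * v.1 * w.1 + v.2.1 * w.2.2 + v.2.2 * w.2.1 = 0 then 1 else 0) : ℤ) =
          (Fintype.card F : ℤ) ^ 2 +
            if v = 0 then (Fintype.card F : ℤ) ^ 3 - (Fintype.card F : ℤ) ^ 2 else 0 := by
        intro v
        by_cases hv : v = 0
        · subst hv
          simp [Fintype.card_prod]
          ring
        · let φ : F × F × F →ₗ[F] F :=
            { toFun := fun w => 2 * v.1 * w.1 + v.2.1 * w.2.2 + v.2.2 * w.2.1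
              map_add' := fun w w' => by simp; ring
              map_smul' := fun r w => by simp; ring }
          have hφ : φ ≠ 0 := by
            intro h
            apply hv
            have e1 : φ (1, 0, 0) = 0 := by rw [h]; rfl
            have e3 : φ (0, 1, 0) = 0 := by rw [h]; rfl
            have e4 : φ (0, 0, 1) = 0 := by rw [h]; rfl
            simp [φ, h2] at e1 e3 e4
            ext <;> simp [e1, e3, e4]
          have := card_mul_sum_fiber_of_ne_zero φ hφ 0
          apply mul_left_cancel₀ hq
          refine this.trans ?_
          simp [hv, Fintype.card_prod]
          ring
      simp only [mul_zero, zero_mul, zero_add, and_true, inner, if_true,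
        Finset.sum_add_distrib, Finset.sum_ite_eq', Finset.mem_univ]
      simp [Fintype.card_prod]
      ring
    · have inner : ∀ v w : F × F × F,
          (2 * (0 * y) + (2 * v.1 * w.1 + v.2.1 * w.2.2 + v.2.2 * w.2.1) = 0 ∧
            0 * w.1 + y * v.1 = 0 ∧ 0 * w.2.1 + y * v.2.1 = 0 ∧ 0 * w.2.2 + y * v.2.2 = 0) ↔
          v = 0 := by
        rintro ⟨a, b, c⟩ ⟨d, e, f⟩
        simp only [Prod.mk_eq_zero]
        constructor
        · rintro ⟨-, h⟩
          simpa [hy] using h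
        · rintro ⟨rfl, rfl, rfl⟩
          simp
      simp only [inner]
      rw [Finset.sum_comm]
      simp [hy, Fintype.card_prod]
      ring
  · have inner : ∀ v w : F × F × F,
        (2 * (x * y) + (2 * v.1 * w.1 + v.2.1 * w.2.2 + v.2.2 * w.2.1) = 0 ∧
          x * w.1 + y * v.1 = 0 ∧ x * w.2.1 + y * v.2.1 = 0 ∧ x * w.2.2 + y * v.2.2 = 0) ↔
        (w = (-(y / x)) • v ∧ (y = 0 ∨ v.1 * v.1 + v.2.1 * v.2.2 = x * x)) := by
      rintro ⟨a, b, c⟩ ⟨d, e, f⟩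
      have solve : ∀ s t : F, x * s + y * t = 0 ↔ s = -(y / x) * t := by
        intro s t
        constructor
        · intro h
          field_simp
          linear_combination h
        · rintro rfl
          field_simp
          ring
      simp only [solve, Prod.smul_mk, smul_eq_mul, Prod.mk.injEq]
      rw [and_comm]
      refine and_congr_right ?_
      rintro ⟨rfl, rfl, rfl⟩
      have factor : 2 * (x * y) + (2 * a * (-(y / x) * a) + b * (-(y / x) * c) +
          c * (-(y / x) * b)) = (2 * y / x) * (x * x - (a * a + b * c)) := by
        field_simp
        ring
      rw [factor]
      simp [h2, hx, sub_eq_zero, eq_comm (a := x * x)]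
    simp only [inner, ite_and, Finset.sum_ite_eq', Finset.mem_univ, if_true, hx, if_false]
    by_cases hy : y = 0
    · simp [hy, Fintype.card_prod]
      ring
    · simp only [hy, false_or, if_false, Fintype.sum_prod_type]
      exact sum_split_quadric h2 hx

/-- The number of anticommuting pairs of 2×2 matrices. -/
theorem sum_anticommute {F : Type*} [Field F] [Fintype F] [DecidableEq F] (h2 : (2 : F) ≠ 0) :
    (∑ X : Matrix (Fin 2) (Fin 2) F, ∑ Y : Matrix (Fin 2) (Fin 2) F,
      (if X * Y + Y * X = 0 then 1 else 0) : ℤ) =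
      (Fintype.card F : ℤ) ^ 5 + 3 * (Fintype.card F : ℤ) ^ 4 - 2 * (Fintype.card F : ℤ) ^ 3
        - 2 * (Fintype.card F : ℤ) ^ 2 + Fintype.card F := by
  have hb := halfTraceMatrix_bijective h2
  have expand : (∑ X : Matrix (Fin 2) (Fin 2) F, ∑ Y : Matrix (Fin 2) (Fin 2) F,
      (if X * Y + Y * X = 0 then 1 else 0) : ℤ) =
      ∑ x : F, ∑ y : F, ∑ v : F × F × F, ∑ w : F × F × F,
        (if 2 * (x * y) + (2 * v.1 * w.1 + v.2.1 * w.2.2 + v.2.2 * w.2.1) = 0 ∧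
          x * w.1 + y * v.1 = 0 ∧ x * w.2.1 + y * v.2.1 = 0 ∧ x * w.2.2 + y * v.2.2 = 0
        then 1 else 0) := by
    rw [← hb.sum_comp, Fintype.sum_prod_type]
    refine Finset.sum_congr rfl fun x _ => ?_
    conv_rhs => rw [Finset.sum_comm]
    refine Finset.sum_congr rfl fun v _ => ?_
    rw [← hb.sum_comp, Fintype.sum_prod_type]
    refine Finset.sum_congr rfl fun y _ => Finset.sum_congr rfl fun w _ => ?_
    exact if_congr (halfTraceMatrix_anticommute_iff h2 x v.1 v.2.1 v.2.2 y w.1 w.2.1 w.2.2) rfl rfl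
  rw [expand]
  simp only [sum_anticommute_fixed_halfTrace h2]
  have outer : ∀ α β γ : ℤ, (∑ x : F, ∑ y : F,
      (if x = 0 then if y = 0 then α else β else if y = 0 then β else γ)) =
      α + 2 * (Fintype.card F - 1) * β + (Fintype.card F - 1) ^ 2 * γ := by
    intro α β γ
    have row : ∀ a b : ℤ, ∑ y : F, (if y = 0 then a else b) = a + (Fintype.card F - 1) * b := by
      intro a b
      have : ∀ y : F, (if y = 0 then a else b) = b + if y = 0 then a - b else 0 := by
        intro y
        split_ifs <;> ring
      simp only [this, Finset.sum_add_distrib, Finset.sum_ite_eq', Finset.mem_univ, if_true]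
      simp
      ring
    have pull : ∀ x : F, (∑ y : F,
        (if x = 0 then if y = 0 then α else β else if y = 0 then β else γ)) =
        if x = 0 then α + (Fintype.card F - 1) * β else β + (Fintype.card F - 1) * γ := by
      intro x
      split_ifs <;> exact row _ _
    simp only [pull, row]
    ring
  rw [outer]
  ring

theorem card_matrix_two {F : Type*} [Field F] [Fintype F] :
    (Fintype.card (Matrix (Fin 2) (Fin 2) F) : ℤ) = (Fintype.card F : ℤ) ^ 4 := by
  rw [Module.card_eq_pow_finrank (K := F) (V := Matrix (Fin 2) (Fin 2) F), Module.finrank_matrix]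
  simp

/-- The number of `Z` with `Tr(XYZ + XZY) = k`. -/
theorem sum_trace_fiber {F : Type*} [Field F] [Fintype F] [DecidableEq F]
    (X Y : Matrix (Fin 2) (Fin 2) F) (k : F) :
    (∑ Z : Matrix (Fin 2) (Fin 2) F,
      (if Matrix.trace (X * Y * Z + X * Z * Y) = k then 1 else 0) : ℤ) =
      (Fintype.card F : ℤ) ^ 3 + (if X * Y + Y * X = 0 then 1 else 0) *
        ((if k = 0 then (Fintype.card F : ℤ) ^ 4 else 0) - (Fintype.card F : ℤ) ^ 3) := by
  have hq : (Fintype.card F : ℤ) ≠ 0 := by simp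
  have htr : ∀ Z : Matrix (Fin 2) (Fin 2) F,
      Matrix.trace (X * Y * Z + X * Z * Y) = Matrix.trace ((X * Y + Y * X) * Z) := by
    intro Z
    rw [add_mul, Matrix.trace_add, Matrix.trace_add, Matrix.trace_mul_cycle X Z Y]
  simp only [htr]
  by_cases h : X * Y + Y * X = 0
  · by_cases hk : k = 0
    · simp [h, hk, card_matrix_two]
    · simp [h, hk, Ne.symm hk]
  · let φ : Matrix (Fin 2) (Fin 2) F →ₗ[F] F :=
      Matrix.traceLinearMap (Fin 2) F F ∘ₗ LinearMap.mulLeft F (X * Y + Y * X)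
    have hφ : φ ≠ 0 := fun h0 => h (Matrix.ext_iff_trace_mul_right.2 fun Z => by
      simpa [φ] using LinearMap.congr_fun h0 Z)
    apply mul_left_cancel₀ hq
    refine (card_mul_sum_fiber_of_ne_zero φ hφ k).trans ?_
    rw [card_matrix_two]
    simp [h]
    ring

/-- The fibers of the functional `Tr(XYZ + XZY)` on triples of 2×2 matrices. -/
theorem card_trace_fiber {F : Type*} [Field F] [Fintype F] [DecidableEq F] (h2 : (2 : F) ≠ 0)
    (k : F) :
    (Nat.card {t : Matrix (Fin 2) (Fin 2) F × Matrix (Fin 2) (Fin 2) F ×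
          Matrix (Fin 2) (Fin 2) F //
        Matrix.trace (t.1 * t.2.1 * t.2.2 + t.1 * t.2.2 * t.2.1) = k} : ℤ) =
      (Fintype.card F : ℤ) ^ 11 +
        ((Fintype.card F : ℤ) ^ 5 + 3 * (Fintype.card F : ℤ) ^ 4 - 2 * (Fintype.card F : ℤ) ^ 3
          - 2 * (Fintype.card F : ℤ) ^ 2 + Fintype.card F) *
        ((if k = 0 then (Fintype.card F : ℤ) ^ 4 else 0) - (Fintype.card F : ℤ) ^ 3) := by
  rw [Nat.card_eq_fintype_card, Fintype.card_subtype, Finset.card_filter]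
  push_cast
  simp only [Fintype.sum_prod_type, sum_trace_fiber, Finset.sum_add_distrib, ← Finset.sum_mul,
    sum_anticommute h2]
  simp [card_matrix_two]
  ring


/-- over a finite field `F` with `q` elements of odd characteristic, the fibers
of the Chern–Simons functional `Tr(XYZ + XZY)` on triples of 2×2 matrices have
`q^{11} − q^8 − 3q^7 + 2q^6 + 2q^5 − q^4` points over `1` and
`q^{11} + q^9 + 2q^8 − 5q^7 + 3q^5 − q^4` points over `0`; in particular the difference of
the two counts is `q^4(q^5 + 3q^4 − 2q^3 − 2q^2 + q)`. -/
theorem card_fibers_chern_simons_quantum_affine_space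
    (F : Type) [Field F] [Fintype F] (hchar : ringChar F ≠ 2) :
    (Nat.card {t : Matrix (Fin 2) (Fin 2) F × Matrix (Fin 2) (Fin 2) F ×
          Matrix (Fin 2) (Fin 2) F //
        Matrix.trace (t.1 * t.2.1 * t.2.2 + t.1 * t.2.2 * t.2.1) = 1} : ℤ) =
      (Fintype.card F : ℤ) ^ 11 - (Fintype.card F : ℤ) ^ 8 - 3 * (Fintype.card F : ℤ) ^ 7
        + 2 * (Fintype.card F : ℤ) ^ 6 + 2 * (Fintype.card F : ℤ) ^ 5
        - (Fintype.card F : ℤ) ^ 4 ∧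
    (Nat.card {t : Matrix (Fin 2) (Fin 2) F × Matrix (Fin 2) (Fin 2) F ×
          Matrix (Fin 2) (Fin 2) F //
        Matrix.trace (t.1 * t.2.1 * t.2.2 + t.1 * t.2.2 * t.2.1) = 0} : ℤ) =
      (Fintype.card F : ℤ) ^ 11 + (Fintype.card F : ℤ) ^ 9 + 2 * (Fintype.card F : ℤ) ^ 8
        - 5 * (Fintype.card F : ℤ) ^ 7 + 3 * (Fintype.card F : ℤ) ^ 5
        - (Fintype.card F : ℤ) ^ 4 ∧
    (Nat.card {t : Matrix (Fin 2) (Fin 2) F × Matrix (Fin 2) (Fin 2) F ×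
          Matrix (Fin 2) (Fin 2) F //
        Matrix.trace (t.1 * t.2.1 * t.2.2 + t.1 * t.2.2 * t.2.1) = 0} : ℤ) -
      (Nat.card {t : Matrix (Fin 2) (Fin 2) F × Matrix (Fin 2) (Fin 2) F ×
          Matrix (Fin 2) (Fin 2) F //
        Matrix.trace (t.1 * t.2.1 * t.2.2 + t.1 * t.2.2 * t.2.1) = 1} : ℤ) =
      (Fintype.card F : ℤ) ^ 4 *
        ((Fintype.card F : ℤ) ^ 5 + 3 * (Fintype.card F : ℤ) ^ 4
          - 2 * (Fintype.card F : ℤ) ^ 3 - 2 * (Fintype.card F : ℤ) ^ 2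
          + (Fintype.card F : ℤ)) := by
  classical
  have h2 : (2 : F) ≠ 0 := Ring.two_ne_zero hchar
  simp only [card_trace_fiber h2, one_ne_zero, if_true, if_false]
  refine ⟨?_, ?_, ?_⟩ <;> ring
end

section
/- Let F be a finite field with q elements whose characteristic is neither 2 nor 3, and set c = #{x ∈ F : 2x³ + 3 = 0}. Then the number of tuples (n,p,r,s,t,v,x,z) ∈ F^8 satisfying −(1/3)n³ − (1/3)r³ + (v−s)p + (n−r)t = 1 equals q^7 + (c−1)·q^5. -/
/-- Parametrization of the points with `n ≠ r`, solving for `t`. -/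
def paramNeR (F : Type) [Field F] :
    Fˣ × F × F × F × F × F × F → F × F × F × F × F × F × F × F :=
  fun (b, p, r, s, v, x, z) =>
    (r + b, p, r, s,
      (1 + (3 : F)⁻¹ * (r + b) ^ 3 + (3 : F)⁻¹ * r ^ 3 - (v - s) * p) * (b : F)⁻¹, v, x, z)

/-- Parametrization of the points with `n = r` and `v ≠ s`, solving for `p`. -/
def paramNeS (F : Type) [Field F] :
    Fˣ × F × F × F × F × F → F × F × F × F × F × F × F × F :=
  fun (a, n, s, t, x, z) =>
    (n, (1 + (3 : F)⁻¹ * n ^ 3 + (3 : F)⁻¹ * n ^ 3) * (a : F)⁻¹, n, s, t, s + a, x, z)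

/-- Parametrization of the points with `n = r` and `v = s`. -/
def paramEq (F : Type) [Field F] :
    {x : F // 2 * x ^ 3 + 3 = 0} × F × F × F × F × F → F × F × F × F × F × F × F × F :=
  fun (n, p, s, t, x, z) => (n, p, n, s, t, s, x, z)

theorem injective_sumElim_param (F : Type) [Field F] :
    Function.Injective (Sum.elim (paramNeR F) (Sum.elim (paramNeS F) (paramEq F))) := by
  refine Function.Injective.sumElim ?_ (Function.Injective.sumElim ?_ ?_ ?_) ?_
  · rintro ⟨b, p, r, s, v, x, z⟩ ⟨b', p', r', s', v', x', z'⟩ h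
    simp only [paramNeR, Prod.mk.injEq] at h ⊢
    obtain ⟨h1, rfl, rfl, rfl, -, rfl, rfl, rfl⟩ := h
    exact ⟨Units.ext (add_left_cancel h1), rfl, rfl, rfl, rfl, rfl, rfl⟩
  · rintro ⟨a, n, s, t, x, z⟩ ⟨a', n', s', t', x', z'⟩ h
    simp only [paramNeS, Prod.mk.injEq] at h ⊢
    obtain ⟨rfl, -, -, rfl, rfl, h1, rfl, rfl⟩ := h
    exact ⟨Units.ext (add_left_cancel h1), rfl, rfl, rfl, rfl, rfl⟩
  · rintro ⟨n, p, s, t, x, z⟩ ⟨n', p', s', t', x', z'⟩ h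
    simp only [paramEq, Prod.mk.injEq] at h ⊢
    obtain ⟨h1, rfl, -, rfl, rfl, -, rfl, rfl⟩ := h
    exact ⟨Subtype.ext h1, rfl, rfl, rfl, rfl, rfl⟩
  · rintro ⟨a, n, s, t, x, z⟩ ⟨n', p', s', t', x', z'⟩ h
    simp only [paramNeS, paramEq, Prod.mk.injEq] at h
    obtain ⟨-, -, -, rfl, -, h1, -⟩ := h
    simp at h1
  · rintro ⟨b, p, r, s, v, x, z⟩ (⟨a, n, s', t, x', z'⟩ | ⟨n, p', s', t, x', z'⟩) h <;>
    · simp only [Sum.elim_inl, Sum.elim_inr, paramNeR, paramNeS, paramEq, Prod.mk.injEq] at h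
      obtain ⟨h1, -, rfl, -⟩ := h
      simp at h1

theorem mem_range_sumElim_param (F : Type) [Field F] (h3 : (3 : F) ≠ 0)
    (n p r s t v x z : F) :
    (n, p, r, s, t, v, x, z) ∈
        Set.range (Sum.elim (paramNeR F) (Sum.elim (paramNeS F) (paramEq F))) ↔
      -(3 : F)⁻¹ * n ^ 3 - (3 : F)⁻¹ * r ^ 3 + (v - s) * p + (n - r) * t = 1 := by
  have key (n : F) : 2 * n ^ 3 + 3 = 0 ↔ -(3 : F)⁻¹ * n ^ 3 - (3 : F)⁻¹ * n ^ 3 = 1 := by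
    field_simp
    constructor <;> intro h <;> linear_combination -h
  constructor
  · rintro ⟨⟨b, p', r', s', v', x', z'⟩ | ⟨a, n', s', t', x', z'⟩ |
      ⟨⟨n', hn⟩, p', s', t', x', z'⟩, h⟩
    · simp only [Sum.elim_inl, paramNeR, Prod.mk.injEq] at h
      obtain ⟨rfl, rfl, rfl, rfl, rfl, rfl, rfl, rfl⟩ := h
      linear_combination (1 + (3 : F)⁻¹ * (r' + b) ^ 3 + (3 : F)⁻¹ * r' ^ 3 - (v' - s') * p') *
        mul_inv_cancel₀ b.ne_zero
    · simp only [Sum.elim_inl, Sum.elim_inr, paramNeS, Prod.mk.injEq] at h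
      obtain ⟨rfl, rfl, rfl, rfl, rfl, rfl, rfl, rfl⟩ := h
      linear_combination (1 + (3 : F)⁻¹ * n' ^ 3 + (3 : F)⁻¹ * n' ^ 3) *
        mul_inv_cancel₀ a.ne_zero
    · simp only [Sum.elim_inr, paramEq, Prod.mk.injEq] at h
      obtain ⟨rfl, rfl, rfl, rfl, rfl, rfl, rfl, rfl⟩ := h
      linear_combination (key n').1 hn
  · intro h
    by_cases hb : n = r
    · subst hb
      by_cases ha : v = s
      · subst ha
        exact ⟨.inr (.inr (⟨n, (key n).2 (by linear_combination h)⟩, p, v, t, x, z)), rfl⟩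
      · have ha' : v - s ≠ 0 := sub_ne_zero.2 ha
        refine ⟨.inr (.inl (Units.mk0 _ ha', n, s, t, x, z)), ?_⟩
        simp only [Sum.elim_inl, Sum.elim_inr, paramNeS, Units.val_mk0, Prod.mk.injEq,
          add_sub_cancel, true_and, and_true]
        rw [← div_eq_mul_inv, div_eq_iff ha']
        linear_combination -h
    · have hb' : n - r ≠ 0 := sub_ne_zero.2 hb
      refine ⟨.inl (Units.mk0 _ hb', p, r, s, v, x, z), ?_⟩
      simp only [Sum.elim_inl, paramNeR, Units.val_mk0, Prod.mk.injEq,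
        add_sub_cancel, true_and, and_true]
      rw [← div_eq_mul_inv, div_eq_iff hb']
      linear_combination -h

/-- over a finite field `F` with `q` elements of characteristic not 2 or 3,
with `c = #{x : 2x³ + 3 = 0}`, the number of tuples `(n,p,r,s,t,v,x,z) ∈ F^8` with
`−(1/3)n³ − (1/3)r³ + (v−s)p + (n−r)t = 1` (the cell `S₃` of the Brauer–Severi scheme of
the homogenized Weyl algebra, fiber over 1) equals `q^7 + (c−1)q^5`. -/
theorem card_cell3_homogenized_weyl_fiber_one
    (F : Type) [Field F] [Fintype F] (h2 : ringChar F ≠ 2) (h3 : ringChar F ≠ 3) :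
    (Nat.card {(n, p, r, s, t, v, x, z) : F × F × F × F × F × F × F × F |
        -(3 : F)⁻¹ * n ^ 3 - (3 : F)⁻¹ * r ^ 3 + (v - s) * p + (n - r) * t = 1} : ℤ) =
      (Fintype.card F : ℤ) ^ 7 +
        ((Nat.card {x : F // 2 * x ^ 3 + 3 = 0} : ℤ) - 1) * (Fintype.card F : ℤ) ^ 5 := by
  have h3' : (3 : F) ≠ 0 := fun h => by
    have hd : ringChar F ∣ 3 := ringChar.dvd (by exact_mod_cast h)
    rcases (Nat.dvd_prime Nat.prime_three).1 hd with h1 | h1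
    · exact CharP.ringChar_ne_one h1
    · exact h3 h1
  have hu : (Nat.card Fˣ : ℤ) = Fintype.card F - 1 := by
    rw [Nat.card_units, Nat.card_eq_fintype_card, Nat.cast_sub Fintype.card_pos, Nat.cast_one]
  rw [← Nat.card_congr ((Equiv.ofInjective _ (injective_sumElim_param F)).trans
    (Equiv.setCongr (Set.ext fun ⟨n, p, r, s, t, v, x, z⟩ =>
      mem_range_sumElim_param F h3' n p r s t v x z)))]
  simp only [Nat.card_sum, Nat.card_prod, Nat.cast_add, Nat.cast_mul, hu]
  rw [Nat.card_eq_fintype_card (α := F)]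
  ring
end

section
/- Let F be a finite field with q elements whose characteristic is neither 2 nor 3, and set c = #{x ∈ F : 2x³ + 3 = 0}. Then the number of tuples (n,p,r,t,v,w,x,y,z) ∈ F^9 satisfying −(1/3)n³ − (1/3)r³ + (vp + (n−r)t)·y + (w−z)p + (r−n)x = 1 equals q^8 + (c−1)·q^6. -/
theorem ringChar_ne_natCast_ne_zero {F : Type*} [Field F] {p : ℕ} (hp : p.Prime)
    (h : ringChar F ≠ p) : (p : F) ≠ 0 := by
  intro h0
  rcases (Nat.dvd_prime hp).1 (ringChar.dvd h0) with h1 | h1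
  · exact CharP.ringChar_ne_one h1
  · exact h h1

/-- The number of solutions `b` of a linear equation `g * b = f` over a finite field. -/
theorem card_linear_equation {F : Type*} [Field F] [Fintype F] [DecidableEq F] (f g : F) :
    (Nat.card {b : F // g * b = f} : ℤ) =
      1 - (if g = 0 then 1 else 0) + Nat.card F * (if g = 0 ∧ f = 0 then 1 else 0) := by
  by_cases hg : g = 0
  · subst hg
    by_cases hf : f = 0
    · subst hf
      simp
    · have : IsEmpty {b : F // 0 * b = f} := ⟨fun b => hf (by simpa using b.2.symm)⟩
      rw [Nat.card_of_isEmpty]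
      simp [hf]
  · have : Unique {b : F // g * b = f} :=
      { default := ⟨f / g, mul_div_cancel₀ f hg⟩
        uniq := fun b => Subtype.ext ((eq_div_iff hg).2 (by rw [mul_comm]; exact b.2)) }
    simp [hg]

/-- The number of solutions `(a, b)` of a family of linear equations `g a * b = f a`
parametrized by a finite type. -/
theorem card_linear_family {F α : Type*} [Field F] [Fintype F] [Fintype α] (f g : α → F) :
    (Nat.card {x : α × F // g x.1 * x.2 = f x.1} : ℤ) =
      Nat.card α - Nat.card {a // g a = 0} +
        Nat.card F * Nat.card {a // g a = 0 ∧ f a = 0} := by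
  classical
  have e : {x : α × F // g x.1 * x.2 = f x.1} ≃ Σ a, {b : F // g a * b = f a} :=
    { toFun := fun x => ⟨x.1.1, x.1.2, x.2⟩
      invFun := fun x => ⟨(x.1, x.2.1), x.2.2⟩
      left_inv := fun _ => rfl
      right_inv := fun _ => rfl }
  rw [Nat.card_congr e]
  simp only [Nat.card_sigma, Nat.cast_sum, card_linear_equation,
    Finset.sum_add_distrib, Finset.sum_sub_distrib, ← Finset.mul_sum, Finset.sum_boole]
  simp [Fintype.card_subtype]

/-- over a finite field `F` with `q` elements of characteristic not 2 or 3,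
with `c = #{x : 2x³ + 3 = 0}`, the number of tuples `(n,p,r,t,v,w,x,y,z) ∈ F^9` with
`−(1/3)n³ − (1/3)r³ + (vp + (n−r)t)y + (w−z)p + (r−n)x = 1` (the cell `S₂` of the
Brauer–Severi scheme of the homogenized Weyl algebra, fiber over 1) equals
`q^8 + (c−1)q^6`. -/
theorem card_cell2_homogenized_weyl_fiber_one
    (F : Type) [Field F] [Fintype F] (h2 : ringChar F ≠ 2) (h3 : ringChar F ≠ 3) :
    (Nat.card {(n, p, r, t, v, w, x, y, z) : F × F × F × F × F × F × F × F × F |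
        -(3 : F)⁻¹ * n ^ 3 - (3 : F)⁻¹ * r ^ 3 + (v * p + (n - r) * t) * y
          + (w - z) * p + (r - n) * x = 1} : ℤ) =
      (Fintype.card F : ℤ) ^ 8 +
        ((Nat.card {x : F // 2 * x ^ 3 + 3 = 0} : ℤ) - 1) * (Fintype.card F : ℤ) ^ 6 := by
  have three : (3 : F) ≠ 0 := by
    exact_mod_cast ringChar_ne_natCast_ne_zero Nat.prime_three h3
  have root_iff (n : F) : 3⁻¹ * n ^ 3 + 3⁻¹ * n ^ 3 + 1 = 0 ↔ 2 * n ^ 3 + 3 = 0 := by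
    field_simp
    ring_nf
  let f : F × F × F × F × F × F × F × F → F := fun (n, p, r, t, v, x, y, z) =>
    1 - (-(3 : F)⁻¹ * n ^ 3 - (3 : F)⁻¹ * r ^ 3 + (v * p + (n - r) * t) * y
      - z * p + (r - n) * x)
  let g : F × F × F × F × F × F × F × F → F := fun a => a.2.1
  let f' : F × F × F × F → F := fun (n, r, t, y) =>
    3⁻¹ * n ^ 3 + 3⁻¹ * r ^ 3 + 1 - (n - r) * t * y
  let g' : F × F × F × F → F := fun (n, r, _, _) => r - n
  have e₁ : {(n, p, r, t, v, w, x, y, z) : F × F × F × F × F × F × F × F × F |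
        -(3 : F)⁻¹ * n ^ 3 - (3 : F)⁻¹ * r ^ 3 + (v * p + (n - r) * t) * y
          + (w - z) * p + (r - n) * x = 1} ≃ {x : (F × F × F × F × F × F × F × F) × F // g x.1 * x.2 = f x.1} :=
    { toFun := fun ⟨(n, p, r, t, v, w, x, y, z), h⟩ => ⟨((n, p, r, t, v, x, y, z), w), by
        simp only [Set.mem_ofPred_eq] at h
        simp only [f, g]
        linear_combination h⟩
      invFun := fun ⟨((n, p, r, t, v, x, y, z), w), h⟩ => ⟨(n, p, r, t, v, w, x, y, z), by
        simp only [f, g] at h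
        simp only [Set.mem_ofPred_eq]
        linear_combination h⟩
      left_inv := fun _ => rfl
      right_inv := fun _ => rfl }
  have e₂ : {a // g a = 0} ≃ F × F × F × F × F × F × F :=
    { toFun := fun a => (a.1.1, a.1.2.2)
      invFun := fun a => ⟨(a.1, 0, a.2), rfl⟩
      left_inv := fun ⟨(_, _, _), h⟩ => Subtype.ext (by simpa [g] using h.symm)
      right_inv := fun _ => rfl }
  have e₃ : {a // g a = 0 ∧ f a = 0} ≃ {x : (F × F × F × F) × F // g' x.1 * x.2 = f' x.1} × F × F :=
    { toFun := fun ⟨(n, p, r, t, v, x, y, z), h⟩ => (⟨((n, r, t, y), x), by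
        obtain ⟨hp, h⟩ := h
        simp only [f, g] at h hp
        simp only [f', g']
        subst hp
        linear_combination -h⟩, v, z)
      invFun := fun ⟨⟨((n, r, t, y), x), h⟩, v, z⟩ => ⟨(n, 0, r, t, v, x, y, z), rfl, by
        simp only [f', g'] at h
        simp only [f]
        linear_combination -h⟩
      left_inv := fun ⟨(n, p, r, t, v, x, y, z), h⟩ => Subtype.ext (by
        simpa [g] using h.1.symm)
      right_inv := fun _ => rfl }
  have e₄ : {a // g' a = 0} ≃ F × F × F :=
    { toFun := fun a => a.1.2
      invFun := fun a => ⟨(a.1, a), sub_self _⟩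
      left_inv := fun ⟨(_, _, _, _), h⟩ => Subtype.ext (by
        simpa [g', sub_eq_zero] using h)
      right_inv := fun _ => rfl }
  have e₅ : {a // g' a = 0 ∧ f' a = 0} ≃ {x : F // 2 * x ^ 3 + 3 = 0} × F × F :=
    { toFun := fun ⟨(n, r, t, y), h⟩ => (⟨r, by
        obtain ⟨hr, h⟩ := h
        obtain rfl : r = n := sub_eq_zero.1 hr
        exact (root_iff r).1 (by simpa [f'] using h)⟩, t, y)
      invFun := fun ⟨⟨n, h⟩, t, y⟩ => ⟨(n, n, t, y), sub_self n, by
        simpa [f'] using (root_iff n).2 h⟩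
      left_inv := fun ⟨(_, _, _, _), h⟩ => Subtype.ext (by
        simpa [g', sub_eq_zero] using h.1)
      right_inv := fun _ => rfl }
  rw [Nat.card_congr e₁, card_linear_family, Nat.card_congr e₂, Nat.card_congr e₃,
    Nat.card_prod _ (F × F), Nat.cast_mul, card_linear_family, Nat.card_congr e₄,
    Nat.card_congr e₅]
  simp only [Nat.card_prod, Nat.cast_mul, ← Nat.card_eq_fintype_card]
  ring
end

section
/- Let F be a finite field with q elements whose characteristic is neither 2 nor 3. Then the number of tuples (p,r,s,t,u,v,w,x,y,z) ∈ F^{10} satisfying −(1/3)r³ + ((w−z)p + rx)·u + ((v−s)p − rt)·y − rp + (z−w)t + (s−v)x = 1 equals q^9 − q^6. -/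
/-- Splitting off one hyperbolic plane: the solutions of `a * t + f x = 1` either have `a ≠ 0`,
and then `t` is determined, or `a = 0`, and then `t` is free. -/
def hyperbolicFiberEquiv {F α : Type*} [Field F] [DecidableEq F] (f : α → F) :
    {x : F × F × α // x.1 * x.2.1 + f x.2.2 = 1} ≃ (Fˣ × α) ⊕ (F × {x : α // f x = 1}) where
  toFun x := if h : x.1.1 = 0 then .inr (x.1.2.1, ⟨x.1.2.2, by simpa [h] using x.2⟩)
    else .inl (Units.mk0 x.1.1 h, x.1.2.2)
  invFun
    | .inl (a, x) => ⟨(a, (a : F)⁻¹ * (1 - f x), x), by simp⟩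
    | .inr (t, x) => ⟨(0, t, x), by simpa using x.2⟩
  left_inv := by
    rintro ⟨⟨a, t, x⟩, h⟩
    by_cases ha : a = 0
    · simp [ha]
    · have ht : a⁻¹ * (1 - f x) = t := by
        simp only at h
        rw [← h, add_sub_cancel_right, inv_mul_cancel_left₀ ha]
      simp [ha, ht]
  right_inv := by
    rintro (⟨a, x⟩ | ⟨t, x⟩) <;> simp

theorem card_hyperbolicFiber {F α : Type*} [Field F] [Fintype F] [Finite α] (f : α → F) :
    (Nat.card {x : F × F × α // x.1 * x.2.1 + f x.2.2 = 1} : ℤ) =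
      (Fintype.card F - 1) * Nat.card α + Fintype.card F * Nat.card {x : α // f x = 1} := by
  classical
  rw [Nat.card_congr (hyperbolicFiberEquiv f), Nat.card_sum, Nat.card_prod, Nat.card_prod,
    Nat.card_eq_fintype_card (α := Fˣ), Fintype.card_units, Nat.card_eq_fintype_card (α := F)]
  push_cast [Nat.cast_sub Fintype.card_pos]
  simp

/-- Polynomial coordinates on the cell in which its equation becomes the split quadratic equation
in six variables, with the other four variables free. -/
def cellEquivSplitQuadric (F : Type*) [Field F] :
    {(p, r, s, t, u, v, w, x, y, z) : F × F × F × F × F × F × F × F × F × F |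
        -(3 : F)⁻¹ * r ^ 3 + ((w - z) * p + r * x) * u + ((v - s) * p - r * t) * y
          - r * p + (z - w) * t + (s - v) * x = 1} ≃
      (F × F × F × F) × {x : F × F × F × F × F × F × Unit //
        x.1 * x.2.1 + (x.2.2.1 * x.2.2.2.1 + (x.2.2.2.2.1 * x.2.2.2.2.2.1 + 0)) = 1} where
  toFun := fun ⟨(p, r, s, t, u, v, w, x, y, z), h⟩ =>
    ((s, z, u, y), ⟨(w - z + r * y, p * u - t, v - s - r * u, p * y - x, r,
      -p - (3 : F)⁻¹ * r ^ 2, ()), by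
        simp only [Set.mem_ofPred_eq] at h
        rw [← h]
        ring⟩)
  invFun := fun ⟨(s, z, u, y), ⟨(a, t, b, x, r, p, _), h⟩⟩ =>
    ⟨(-p - (3 : F)⁻¹ * r ^ 2, r, s, (-p - (3 : F)⁻¹ * r ^ 2) * u - t, u, b + r * u + s,
      a - r * y + z, (-p - (3 : F)⁻¹ * r ^ 2) * y - x, y, z), by
        simp only [Set.mem_ofPred_eq] at h ⊢
        rw [← h]
        ring⟩
  left_inv := by
    rintro ⟨⟨p, r, s, t, u, v, w, x, y, z⟩, h⟩
    simp
  right_inv := by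
    rintro ⟨⟨s, z, u, y⟩, ⟨⟨a, t, b, x, r, p, _⟩, h⟩⟩
    simp


/-- over a finite field `F` with `q` elements of characteristic not 2 or 3,
the number of tuples `(p,r,s,t,u,v,w,x,y,z) ∈ F^10` with
`−(1/3)r³ + ((w−z)p + rx)u + ((v−s)p − rt)y − rp + (z−w)t + (s−v)x = 1` (the cell `S₁` of
the Brauer–Severi scheme of the homogenized Weyl algebra, fiber over 1) equals `q^9 − q^6`. -/
theorem card_cell1_homogenized_weyl_fiber_one
    (F : Type) [Field F] [Fintype F] (h2 : ringChar F ≠ 2) (h3 : ringChar F ≠ 3) :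
    (Nat.card {(p, r, s, t, u, v, w, x, y, z) : F × F × F × F × F × F × F × F × F × F |
        -(3 : F)⁻¹ * r ^ 3 + ((w - z) * p + r * x) * u + ((v - s) * p - r * t) * y
          - r * p + (z - w) * t + (s - v) * x = 1} : ℤ) =
      (Fintype.card F : ℤ) ^ 9 - (Fintype.card F : ℤ) ^ 6 := by
  rw [Nat.card_congr (cellEquivSplitQuadric F), Nat.card_prod, Nat.cast_mul,
    card_hyperbolicFiber
      (fun x : F × F × F × F × Unit => x.1 * x.2.1 + (x.2.2.1 * x.2.2.2.1 + 0)),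
    card_hyperbolicFiber (fun x : F × F × Unit => x.1 * x.2.1 + 0),
    card_hyperbolicFiber (fun _ : Unit => (0 : F))]
  simp only [Nat.card_prod, Nat.card_eq_fintype_card (α := F), Nat.card_unique, zero_ne_one,
    Nat.card_of_isEmpty]
  push_cast
  ring
end

section
/- Let F be a finite field with q elements whose characteristic is neither 2 nor 3. Then: (i) the number of tuples (p,r,s,t,u,v,w,x,y,z) ∈ F^{10} satisfying −(1/3)r³ + ((w−z)p + rx)·u + ((v−s)p − rt)·y − rp + (z−w)t + (s−v)x = 0 equals q^9 + q^7 − q^6; (ii) the number of tuples (n,p,r,t,v,w,x,y,z) ∈ F^9 satisfying −(1/3)n³ − (1/3)r³ + (vp + (n−r)t)·y + (w−z)p + (r−n)x = 0 equals q^8; (iii) the number of tuples (n,p,r,s,t,v,x,z) ∈ F^8 satisfying −(1/3)n³ − (1/3)r³ + (v−s)p + (n−r)t = 0 equals q^7. -/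
/-- A set that is bijectively parametrized by a type has the cardinality of that type. -/
theorem Nat.card_set_eq_of_param {A B : Type*} {S : Set A} (f : B → A)
    (hf : Function.Injective f) (hS : ∀ a, a ∈ S ↔ ∃ b, f b = a) : Nat.card S = Nat.card B := by
  have h : S = Set.range f := Set.ext hS
  rw [h, Nat.card_congr (Equiv.ofInjective f hf).symm]

/-- The number of solutions of an affine equation in three unknowns over a finite field. -/
theorem card_affine_equation_three {F : Type*} [Field F] [Fintype F] (c₁ c₂ c₃ b : F)
    (h : ¬(c₁ = 0 ∧ c₂ = 0 ∧ c₃ = 0)) :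
    Nat.card {m : F × F × F | c₁ * m.1 + c₂ * m.2.1 + c₃ * m.2.2 + b = 0} =
      Fintype.card F ^ 2 := by
  have hcard : Nat.card (F × F) = Fintype.card F ^ 2 := by
    simp [Nat.card_eq_fintype_card, sq]
  rw [← hcard]
  by_cases h₁ : c₁ = 0
  · by_cases h₂ : c₂ = 0
    · have h₃ : c₃ ≠ 0 := fun h₃ => h ⟨h₁, h₂, h₃⟩
      refine Nat.card_set_eq_of_param
        (fun k : F × F => (k.1, k.2, -(c₁ * k.1 + c₂ * k.2 + b) / c₃)) ?_ ?_
      · rintro ⟨k, l⟩ ⟨k', l'⟩ hk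
        simp_all
      · rintro ⟨p, x, t⟩
        simp only [Set.mem_ofPred_eq, Prod.exists, Prod.mk.injEq]
        constructor
        · intro e
          refine ⟨p, x, rfl, rfl, ?_⟩
          field_simp
          linear_combination -e
        · rintro ⟨_, _, rfl, rfl, rfl⟩
          field_simp
          ring
    · refine Nat.card_set_eq_of_param
        (fun k : F × F => (k.1, -(c₁ * k.1 + c₃ * k.2 + b) / c₂, k.2)) ?_ ?_
      · rintro ⟨k, l⟩ ⟨k', l'⟩ hk
        simp_all
      · rintro ⟨p, x, t⟩
        simp only [Set.mem_ofPred_eq, Prod.exists, Prod.mk.injEq]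
        constructor
        · intro e
          refine ⟨p, t, rfl, ?_, rfl⟩
          field_simp
          linear_combination -e
        · rintro ⟨_, _, rfl, rfl, rfl⟩
          field_simp
          ring
  · refine Nat.card_set_eq_of_param
      (fun k : F × F => (-(c₂ * k.1 + c₃ * k.2 + b) / c₁, k.1, k.2)) ?_ ?_
    · rintro ⟨k, l⟩ ⟨k', l'⟩ hk
      simp_all
    · rintro ⟨p, x, t⟩
      simp only [Set.mem_ofPred_eq, Prod.exists, Prod.mk.injEq]
      constructor
      · intro e
        refine ⟨x, t, ?_, rfl, rfl⟩
        field_simp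
        linear_combination -e
      · rintro ⟨_, _, rfl, rfl, rfl⟩
        field_simp
        ring

/-- The number of points of a family of affine equations in three unknowns, in terms of the
number of parameters where the linear part, or the whole equation, vanishes. -/
theorem card_affine_family_three {F A : Type*} [Field F] [Fintype F] [Finite A]
    (c₁ c₂ c₃ b : A → F) :
    (Nat.card {m : A × F × F × F |
        c₁ m.1 * m.2.1 + c₂ m.1 * m.2.2.1 + c₃ m.1 * m.2.2.2 + b m.1 = 0} : ℤ) =
      Nat.card A * (Fintype.card F : ℤ) ^ 2
        + Nat.card {a | (c₁ a = 0 ∧ c₂ a = 0 ∧ c₃ a = 0) ∧ b a = 0} * (Fintype.card F : ℤ) ^ 3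
        - Nat.card {a | c₁ a = 0 ∧ c₂ a = 0 ∧ c₃ a = 0} * (Fintype.card F : ℤ) ^ 2 := by
  classical
  have := Fintype.ofFinite A
  have hfib : ∀ a, (Nat.card {m : F × F × F |
      c₁ a * m.1 + c₂ a * m.2.1 + c₃ a * m.2.2 + b a = 0} : ℤ) =
      (Fintype.card F : ℤ) ^ 2
        + (if (c₁ a = 0 ∧ c₂ a = 0 ∧ c₃ a = 0) ∧ b a = 0 then 1 else 0) * (Fintype.card F : ℤ) ^ 3
        - (if c₁ a = 0 ∧ c₂ a = 0 ∧ c₃ a = 0 then 1 else 0) * (Fintype.card F : ℤ) ^ 2 := by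
    intro a
    by_cases h : c₁ a = 0 ∧ c₂ a = 0 ∧ c₃ a = 0
    · by_cases hb : b a = 0
      · simp [h, hb, Nat.card_eq_fintype_card]
        ring
      · simp [h, hb]
    · rw [card_affine_equation_three _ _ _ _ h]
      simp [h]
  have hsigma : Nat.card {m : A × F × F × F |
      c₁ m.1 * m.2.1 + c₂ m.1 * m.2.2.1 + c₃ m.1 * m.2.2.2 + b m.1 = 0} =
      ∑ a, Nat.card {m : F × F × F | c₁ a * m.1 + c₂ a * m.2.1 + c₃ a * m.2.2 + b a = 0} := by
    rw [← Nat.card_sigma]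
    exact Nat.card_congr
      { toFun := fun m => ⟨m.1.1, m.1.2, m.2⟩
        invFun := fun m => ⟨(m.1, m.2.1), m.2.2⟩
        left_inv := fun _ => rfl
        right_inv := fun _ => rfl }
  have hind : ∀ (P : A → Prop) [DecidablePred P],
      (Nat.card {a | P a} : ℤ) = ∑ a, if P a then 1 else 0 := by
    intro P _
    simp [Fintype.card_subtype]
  rw [hsigma, Nat.cast_sum, Finset.sum_congr rfl fun a _ => hfib a, hind, hind,
    Finset.sum_sub_distrib, Finset.sum_add_distrib, ← Finset.sum_mul, ← Finset.sum_mul,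
    Finset.sum_const, Finset.card_univ, nsmul_eq_mul, Nat.card_eq_fintype_card]

theorem eq_zero_of_third_cubes_eq_zero {F : Type*} [Field F] (h2 : ringChar F ≠ 2)
    (h3 : ringChar F ≠ 3) {n : F} (hn : -(3 : F)⁻¹ * n ^ 3 - (3 : F)⁻¹ * n ^ 3 = 0) : n = 0 := by
  have two_ne : (2 : F) ≠ 0 := Ring.two_ne_zero h2
  have three_ne : (3 : F) ≠ 0 := by
    intro h
    have hdvd : ringChar F ∣ 3 := (ringChar.spec F 3).mp (by exact_mod_cast h)
    rcases (Nat.dvd_prime Nat.prime_three).mp hdvd with h1 | h1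
    · exact CharP.ringChar_ne_one h1
    · exact h3 h1
  have h : 2 * n ^ 3 = 0 := by
    field_simp at hn
    linear_combination -hn
  simpa [two_ne] using h

/-- The cell on which `X` maps the first basis vector to the second. -/
theorem card_cell_cyclic_X (F : Type*) [Field F] [Fintype F] :
    (Nat.card {(p, r, s, t, u, v, w, x, y, z) : F × F × F × F × F × F × F × F × F × F |
        -(3 : F)⁻¹ * r ^ 3 + ((w - z) * p + r * x) * u + ((v - s) * p - r * t) * y
          - r * p + (z - w) * t + (s - v) * x = 0} : ℤ) =
      (Fintype.card F : ℤ) ^ 9 + (Fintype.card F : ℤ) ^ 7 - (Fintype.card F : ℤ) ^ 6 := by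
  let c₁ : F × F × F × F × F × F × F → F := fun (r, u, y, w, z, v, s) =>
    (w - z) * u + (v - s) * y - r
  let c₂ : F × F × F × F × F × F × F → F := fun (r, u, y, w, z, v, s) => r * u + s - v
  let c₃ : F × F × F × F × F × F × F → F := fun (r, u, y, w, z, v, s) => -r * y + z - w
  let b : F × F × F × F × F × F × F → F := fun (r, u, y, w, z, v, s) => -(3 : F)⁻¹ * r ^ 3
  let e : (F × F × F × F × F × F × F × F × F × F) ≃ (F × F × F × F × F × F × F) × F × F × F :=
    { toFun := fun (p, r, s, t, u, v, w, x, y, z) => ((r, u, y, w, z, v, s), p, x, t)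
      invFun := fun ((r, u, y, w, z, v, s), p, x, t) => (p, r, s, t, u, v, w, x, y, z)
      left_inv := fun _ => rfl
      right_inv := fun _ => rfl }
  have hzero : Nat.card {a | c₁ a = 0 ∧ c₂ a = 0 ∧ c₃ a = 0} = Nat.card (F × F × F × F) := by
    refine Nat.card_set_eq_of_param (fun (u, y, w, v) => (0, u, y, w, w, v, v)) ?_ ?_
    · rintro ⟨u, y, w, v⟩ ⟨u', y', w', v'⟩ h
      simp only [Prod.mk.injEq] at h ⊢
      tauto
    · rintro ⟨r, u, y, w, z, v, s⟩
      simp only [Set.mem_ofPred_eq, Prod.exists, Prod.mk.injEq, c₁, c₂, c₃]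
      constructor
      · rintro ⟨e₁, e₂, e₃⟩
        have hr : r = 0 := by linear_combination -e₁ - u * e₃ - y * e₂
        subst hr
        exact ⟨u, y, w, v, rfl, rfl, rfl, rfl, by linear_combination -e₃, rfl,
          by linear_combination -e₂⟩
      · rintro ⟨_, _, _, _, rfl, rfl, rfl, rfl, rfl, rfl, rfl⟩
        simp
  have hboth : Nat.card {a | (c₁ a = 0 ∧ c₂ a = 0 ∧ c₃ a = 0) ∧ b a = 0} =
      Nat.card (F × F × F × F) := by
    refine Nat.card_set_eq_of_param (fun (u, y, w, v) => (0, u, y, w, w, v, v)) ?_ ?_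
    · rintro ⟨u, y, w, v⟩ ⟨u', y', w', v'⟩ h
      simp only [Prod.mk.injEq] at h ⊢
      tauto
    · rintro ⟨r, u, y, w, z, v, s⟩
      simp only [Set.mem_ofPred_eq, Prod.exists, Prod.mk.injEq, c₁, c₂, c₃, b]
      constructor
      · rintro ⟨⟨e₁, e₂, e₃⟩, _⟩
        have hr : r = 0 := by linear_combination -e₁ - u * e₃ - y * e₂
        subst hr
        exact ⟨u, y, w, v, rfl, rfl, rfl, rfl, by linear_combination -e₃, rfl,
          by linear_combination -e₂⟩
      · rintro ⟨_, _, _, _, rfl, rfl, rfl, rfl, rfl, rfl, rfl⟩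
        simp
  have hcongr := Nat.card_congr (e.subtypeEquiv
    (p := fun (p, r, s, t, u, v, w, x, y, z) =>
      -(3 : F)⁻¹ * r ^ 3 + ((w - z) * p + r * x) * u + ((v - s) * p - r * t) * y - r * p
        + (z - w) * t + (s - v) * x = 0)
    (q := fun m => c₁ m.1 * m.2.1 + c₂ m.1 * m.2.2.1 + c₃ m.1 * m.2.2.2 + b m.1 = 0) (by
      rintro ⟨p, r, s, t, u, v, w, x, y, z⟩
      simp only [e, c₁, c₂, c₃, b, Equiv.coe_fn_mk]
      ring_nf))
  refine (congrArg Nat.cast hcongr).trans ((card_affine_family_three c₁ c₂ c₃ b).trans ?_)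
  rw [hzero, hboth]
  simp only [Nat.card_eq_fintype_card, Fintype.card_prod]
  push_cast
  ring

/-- The cell on which `Y` maps the first basis vector to the second. -/
theorem card_cell_cyclic_Y (F : Type*) [Field F] [Fintype F] (h2 : ringChar F ≠ 2)
    (h3 : ringChar F ≠ 3) :
    (Nat.card {(n, p, r, t, v, w, x, y, z) : F × F × F × F × F × F × F × F × F |
        -(3 : F)⁻¹ * n ^ 3 - (3 : F)⁻¹ * r ^ 3 + (v * p + (n - r) * t) * y
          + (w - z) * p + (r - n) * x = 0} : ℤ) =
      (Fintype.card F : ℤ) ^ 8 := by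
  let c₁ : F × F × F × F × F × F → F := fun (n, r, v, w, y, z) => v * y + w - z
  let c₂ : F × F × F × F × F × F → F := fun (n, r, v, w, y, z) => r - n
  let c₃ : F × F × F × F × F × F → F := fun (n, r, v, w, y, z) => (n - r) * y
  let b : F × F × F × F × F × F → F := fun (n, r, v, w, y, z) =>
    -(3 : F)⁻¹ * n ^ 3 - (3 : F)⁻¹ * r ^ 3
  let e : (F × F × F × F × F × F × F × F × F) ≃ (F × F × F × F × F × F) × F × F × F :=
    { toFun := fun (n, p, r, t, v, w, x, y, z) => ((n, r, v, w, y, z), p, x, t)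
      invFun := fun ((n, r, v, w, y, z), p, x, t) => (n, p, r, t, v, w, x, y, z)
      left_inv := fun _ => rfl
      right_inv := fun _ => rfl }
  have hzero : Nat.card {a | c₁ a = 0 ∧ c₂ a = 0 ∧ c₃ a = 0} = Nat.card (F × F × F × F) := by
    refine Nat.card_set_eq_of_param (fun (n, v, w, y) => (n, n, v, w, y, v * y + w)) ?_ ?_
    · rintro ⟨n, v, w, y⟩ ⟨n', v', w', y'⟩ h
      simp only [Prod.mk.injEq] at h ⊢
      tauto
    · rintro ⟨n, r, v, w, y, z⟩
      simp only [Set.mem_ofPred_eq, Prod.exists, Prod.mk.injEq, c₁, c₂, c₃]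
      constructor
      · rintro ⟨e₁, e₂, _⟩
        exact ⟨n, v, w, y, rfl, by linear_combination -e₂, rfl, rfl, rfl, by linear_combination e₁⟩
      · rintro ⟨_, _, _, _, rfl, rfl, rfl, rfl, rfl, rfl⟩
        simp
  have hboth : Nat.card {a | (c₁ a = 0 ∧ c₂ a = 0 ∧ c₃ a = 0) ∧ b a = 0} =
      Nat.card (F × F × F) := by
    refine Nat.card_set_eq_of_param (fun (v, w, y) => (0, 0, v, w, y, v * y + w)) ?_ ?_
    · rintro ⟨v, w, y⟩ ⟨v', w', y'⟩ h
      simp only [Prod.mk.injEq] at h ⊢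
      tauto
    · rintro ⟨n, r, v, w, y, z⟩
      simp only [Set.mem_ofPred_eq, Prod.exists, Prod.mk.injEq, c₁, c₂, c₃, b]
      constructor
      · rintro ⟨⟨e₁, e₂, _⟩, e₃⟩
        obtain rfl : r = n := sub_eq_zero.mp e₂
        obtain rfl := eq_zero_of_third_cubes_eq_zero h2 h3 e₃
        exact ⟨v, w, y, rfl, rfl, rfl, rfl, rfl, by linear_combination e₁⟩
      · rintro ⟨_, _, _, rfl, rfl, rfl, rfl, rfl, rfl⟩
        simp
  have hcongr := Nat.card_congr (e.subtypeEquiv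
    (p := fun (n, p, r, t, v, w, x, y, z) =>
      -(3 : F)⁻¹ * n ^ 3 - (3 : F)⁻¹ * r ^ 3 + (v * p + (n - r) * t) * y + (w - z) * p + (r - n) * x = 0)
    (q := fun m => c₁ m.1 * m.2.1 + c₂ m.1 * m.2.2.1 + c₃ m.1 * m.2.2.2 + b m.1 = 0) (by
      rintro ⟨n, p, r, t, v, w, x, y, z⟩
      simp only [e, c₁, c₂, c₃, b, Equiv.coe_fn_mk]
      ring_nf))
  refine (congrArg Nat.cast hcongr).trans ((card_affine_family_three c₁ c₂ c₃ b).trans ?_)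
  rw [hzero, hboth]
  simp only [Nat.card_eq_fintype_card, Fintype.card_prod]
  push_cast
  ring

/-- The cell on which `Z` maps the first basis vector to the second. -/
theorem card_cell_cyclic_Z (F : Type*) [Field F] [Fintype F] (h2 : ringChar F ≠ 2)
    (h3 : ringChar F ≠ 3) :
    (Nat.card {(n, p, r, s, t, v, x, z) : F × F × F × F × F × F × F × F |
        -(3 : F)⁻¹ * n ^ 3 - (3 : F)⁻¹ * r ^ 3 + (v - s) * p + (n - r) * t = 0} : ℤ) =
      (Fintype.card F : ℤ) ^ 7 := by
  let c₁ : F × F × F × F × F → F := fun (n, r, s, v, z) => v - s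
  let c₂ : F × F × F × F × F → F := fun (n, r, s, v, z) => n - r
  let c₃ : F × F × F × F × F → F := fun (n, r, s, v, z) => 0
  let b : F × F × F × F × F → F := fun (n, r, s, v, z) => -(3 : F)⁻¹ * n ^ 3 - (3 : F)⁻¹ * r ^ 3
  let e : (F × F × F × F × F × F × F × F) ≃ (F × F × F × F × F) × F × F × F :=
    { toFun := fun (n, p, r, s, t, v, x, z) => ((n, r, s, v, z), p, t, x)
      invFun := fun ((n, r, s, v, z), p, t, x) => (n, p, r, s, t, v, x, z)
      left_inv := fun _ => rfl
      right_inv := fun _ => rfl }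
  have hzero : Nat.card {a | c₁ a = 0 ∧ c₂ a = 0 ∧ c₃ a = 0} = Nat.card (F × F × F) := by
    refine Nat.card_set_eq_of_param (fun (n, s, z) => (n, n, s, s, z)) ?_ ?_
    · rintro ⟨n, s, z⟩ ⟨n', s', z'⟩ h
      simp only [Prod.mk.injEq] at h ⊢
      tauto
    · rintro ⟨n, r, s, v, z⟩
      simp only [Set.mem_ofPred_eq, Prod.exists, Prod.mk.injEq, c₁, c₂, c₃]
      constructor
      · rintro ⟨e₁, e₂, _⟩
        exact ⟨n, s, z, rfl, sub_eq_zero.mp e₂, rfl, (sub_eq_zero.mp e₁).symm, rfl⟩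
      · rintro ⟨_, _, _, rfl, rfl, rfl, rfl, rfl⟩
        simp
  have hboth : Nat.card {a | (c₁ a = 0 ∧ c₂ a = 0 ∧ c₃ a = 0) ∧ b a = 0} =
      Nat.card (F × F) := by
    refine Nat.card_set_eq_of_param (fun (s, z) => (0, 0, s, s, z)) ?_ ?_
    · rintro ⟨s, z⟩ ⟨s', z'⟩ h
      simp only [Prod.mk.injEq] at h ⊢
      tauto
    · rintro ⟨n, r, s, v, z⟩
      simp only [Set.mem_ofPred_eq, Prod.exists, Prod.mk.injEq, c₁, c₂, c₃, b]
      constructor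
      · rintro ⟨⟨e₁, e₂, _⟩, e₃⟩
        obtain rfl : n = r := sub_eq_zero.mp e₂
        obtain rfl := eq_zero_of_third_cubes_eq_zero h2 h3 e₃
        exact ⟨s, z, rfl, rfl, rfl, (sub_eq_zero.mp e₁).symm, rfl⟩
      · rintro ⟨_, _, rfl, rfl, rfl, rfl, rfl⟩
        simp
  have hcongr := Nat.card_congr (e.subtypeEquiv
    (p := fun (n, p, r, s, t, v, _, _) =>
      -(3 : F)⁻¹ * n ^ 3 - (3 : F)⁻¹ * r ^ 3 + (v - s) * p + (n - r) * t = 0)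
    (q := fun m => c₁ m.1 * m.2.1 + c₂ m.1 * m.2.2.1 + c₃ m.1 * m.2.2.2 + b m.1 = 0) (by
      rintro ⟨n, p, r, s, t, v, x, z⟩
      simp only [e, c₁, c₂, c₃, b, Equiv.coe_fn_mk]
      ring_nf))
  refine (congrArg Nat.cast hcongr).trans ((card_affine_family_three c₁ c₂ c₃ b).trans ?_)
  rw [hzero, hboth]
  simp only [Nat.card_eq_fintype_card, Fintype.card_prod]
  push_cast
  ring

/-- over a finite field `F` with `q` elements of characteristic not 2 or 3,
the three cells `S₁, S₂, S₃` of the Brauer–Severi scheme of the homogenized Weyl algebra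
over the fiber `0` have `q^9 + q^7 − q^6`, `q^8` and `q^7` points respectively. -/
theorem card_cells_homogenized_weyl_fiber_zero
    (F : Type) [Field F] [Fintype F] (h2 : ringChar F ≠ 2) (h3 : ringChar F ≠ 3) :
    (Nat.card {(p, r, s, t, u, v, w, x, y, z) : F × F × F × F × F × F × F × F × F × F |
        -(3 : F)⁻¹ * r ^ 3 + ((w - z) * p + r * x) * u + ((v - s) * p - r * t) * y
          - r * p + (z - w) * t + (s - v) * x = 0} : ℤ) =
      (Fintype.card F : ℤ) ^ 9 + (Fintype.card F : ℤ) ^ 7 - (Fintype.card F : ℤ) ^ 6 ∧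
    (Nat.card {(n, p, r, t, v, w, x, y, z) : F × F × F × F × F × F × F × F × F |
        -(3 : F)⁻¹ * n ^ 3 - (3 : F)⁻¹ * r ^ 3 + (v * p + (n - r) * t) * y
          + (w - z) * p + (r - n) * x = 0} : ℤ) =
      (Fintype.card F : ℤ) ^ 8 ∧
    (Nat.card {(n, p, r, s, t, v, x, z) : F × F × F × F × F × F × F × F |
        -(3 : F)⁻¹ * n ^ 3 - (3 : F)⁻¹ * r ^ 3 + (v - s) * p + (n - r) * t = 0} : ℤ) =
      (Fintype.card F : ℤ) ^ 7 := by
  exact ⟨card_cell_cyclic_X F, card_cell_cyclic_Y F h2 h3, card_cell_cyclic_Z F h2 h3⟩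
end

section
/- Let F be a finite field with q elements of characteristic different from 3, let α, β ∈ F and γ, ε ∈ F with γ ≠ 0 and ε ≠ 0. Then the number of tuples (n,r,s,v,z,p,t,x) ∈ F^8 satisfying α(n³+r³) + β(s³+v³) + γz³ + (1+ε)rvz + (εs+v)p + (n+εr)t + 3γz·x = 1 equals q^7 − q^4 + q^3 · #{(n,s) ∈ F² : α(1−ε^{−3})n³ + β(1−ε³)s³ = 1}. -/
section AffineForm

variable {F : Type*} [Field F]

/-- Projecting away a coordinate with nonzero coefficient identifies the zero locus of an affine
form with the space of the remaining coordinates. -/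
def affineFormSolutionEquiv {V : Type*} (f : V → F) (d : F) (hd : d ≠ 0) :
    {w : V × F // f w.1 + d * w.2 = 1} ≃ V where
  toFun w := w.1.1
  invFun v := ⟨(v, d⁻¹ * (1 - f v)), by simp [hd]⟩
  left_inv := by
    rintro ⟨⟨v, y⟩, h⟩
    have h' : d * y = 1 - f v := by linear_combination h
    simp [← h', hd]
  right_inv _ := rfl

variable [Fintype F]

theorem card_affineForm_solutions_of_ne_zero (c a b d : F) (h : ¬(a = 0 ∧ b = 0 ∧ d = 0)) :
    Nat.card {w : F × F × F // c + a * w.1 + b * w.2.1 + d * w.2.2 = 1} = Fintype.card F ^ 2 := by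
  have key (a b d : F) (hd : d ≠ 0) (e : F × F × F ≃ (F × F) × F)
      (P : F × F × F → Prop)
      (he : ∀ w, P w ↔ (c + a * (e w).1.1 + b * (e w).1.2) + d * (e w).2 = 1) :
      Nat.card {w : F × F × F // P w} = Fintype.card F ^ 2 := by
    rw [Nat.card_congr ((e.subtypeEquiv he).trans
      (affineFormSolutionEquiv (fun v : F × F => c + a * v.1 + b * v.2) d hd))]
    simp [sq]
  by_cases hd : d = 0
  · by_cases hb : b = 0
    · have ha : a ≠ 0 := fun ha => h ⟨ha, hb, hd⟩
      refine key b d a ha (Equiv.prodComm _ _) _ fun w => ?_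
      rw [← sub_eq_zero, ← sub_eq_zero (b := (1 : F))]
      simp only [Equiv.prodComm_apply, Prod.fst_swap, Prod.snd_swap]
      ring_nf
    · refine key a d b hb (((Equiv.refl F).prodCongr (Equiv.prodComm F F)).trans
        (Equiv.prodAssoc F F F).symm) _ fun w => ?_
      simp [add_right_comm]
  · exact key a b d hd (Equiv.prodAssoc F F F).symm _ fun w => by simp

open Classical in
theorem card_affineForm_solutions (c a b d : F) :
    (Nat.card {w : F × F × F // c + a * w.1 + b * w.2.1 + d * w.2.2 = 1} : ℤ) =
      (Fintype.card F : ℤ) ^ 2 + if a = 0 ∧ b = 0 ∧ d = 0 then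
        (if c = 1 then (Fintype.card F : ℤ) ^ 3 else 0) - (Fintype.card F : ℤ) ^ 2 else 0 := by
  split_ifs with h hc
  · obtain ⟨rfl, rfl, rfl⟩ := h
    simp [hc, pow_succ, mul_assoc]
  · obtain ⟨rfl, rfl, rfl⟩ := h
    simp [hc]
  · rw [card_affineForm_solutions_of_ne_zero c a b d h]
    simp

end AffineForm

theorem Nat.card_eq_sum_of_equiv_prod {A B C : Type*} [Fintype B] [Finite C] (e : A ≃ B × C)
    {S : Set A} {P : B → C → Prop} (hS : ∀ w, w ∈ S ↔ P (e w).1 (e w).2) :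
    Nat.card S = ∑ u, Nat.card {w // P u w} := by
  rw [← Nat.card_sigma]
  exact Nat.card_congr ((e.subtypeEquiv (p := (· ∈ S)) (q := fun y => P y.1 y.2) hS).trans
    (Equiv.subtypeProdEquivSigmaSubtype P))

/-- Separates the variables `(n, r, s, v, z)` from `(p, t, x)`. -/
def prodFiveThreeEquiv (F : Type*) :
    F × F × F × F × F × F × F × F ≃ (F × F × F × F × F) × (F × F × F) where
  toFun w := ((w.1, w.2.1, w.2.2.1, w.2.2.2.1, w.2.2.2.2.1), w.2.2.2.2.2)
  invFun w := (w.1.1, w.1.2.1, w.1.2.2.1, w.1.2.2.2.1, w.1.2.2.2.2, w.2)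
  left_inv _ := rfl
  right_inv _ := rfl

/-- over a finite field `F` with `q` elements of characteristic different
from 3, for `α, β ∈ F` and `γ, ε ∈ F` with `γ ≠ 0` and `ε ≠ 0`, the number of tuples
`(n,r,s,v,z,p,t,x) ∈ F^8` with
`α(n³+r³) + β(s³+v³) + γz³ + (1+ε)rvz + (εs+v)p + (n+εr)t + 3γz·x = 1`
equals `q^7 − q^4 + q^3 · #{(n,s) : α(1−ε⁻³)n³ + β(1−ε³)s³ = 1}`. -/
theorem card_cell3_general_cubic_gamma_ne_zero
    (F : Type) [Field F] [Fintype F] (h3 : ringChar F ≠ 3)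
    (α β γ ε : F) (hγ : γ ≠ 0) (hε : ε ≠ 0) :
    (Nat.card {(n, r, s, v, z, p, t, x) : F × F × F × F × F × F × F × F |
        α * (n ^ 3 + r ^ 3) + β * (s ^ 3 + v ^ 3) + γ * z ^ 3 + (1 + ε) * r * v * z
          + (ε * s + v) * p + (n + ε * r) * t + 3 * γ * z * x = 1} : ℤ) =
      (Fintype.card F : ℤ) ^ 7 - (Fintype.card F : ℤ) ^ 4 +
        (Fintype.card F : ℤ) ^ 3 *
          (Nat.card {(n, s) : F × F |
            α * (1 - ε⁻¹ ^ 3) * n ^ 3 + β * (1 - ε ^ 3) * s ^ 3 = 1} : ℤ) := by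
  classical
  have h3' : (3 : F) ≠ 0 := fun h => h3 <| by
    have hdvd : ringChar F ∣ 3 := ringChar.dvd (by exact_mod_cast h)
    exact ((Nat.dvd_prime Nat.prime_three).1 hdvd).resolve_left CharP.ringChar_ne_one
  let c (u : F × F × F × F × F) : F :=
    α * (u.1 ^ 3 + u.2.1 ^ 3) + β * (u.2.2.1 ^ 3 + u.2.2.2.1 ^ 3) + γ * u.2.2.2.2 ^ 3 +
      (1 + ε) * u.2.1 * u.2.2.2.1 * u.2.2.2.2
  let a (u : F × F × F × F × F) : F := ε * u.2.2.1 + u.2.2.2.1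
  let b (u : F × F × F × F × F) : F := u.1 + ε * u.2.1
  let d (u : F × F × F × F × F) : F := 3 * γ * u.2.2.2.2
  let P (u : F × F × F × F × F) (w : F × F × F) : Prop :=
    c u + a u * w.1 + b u * w.2.1 + d u * w.2.2 = 1
  rw [Nat.card_eq_sum_of_equiv_prod (prodFiveThreeEquiv F) (P := P)]
  swap
  · rintro ⟨n, r, s, v, z, p, t, x⟩
    simp only [Set.mem_ofPred_eq, prodFiveThreeEquiv, Equiv.coe_fn_mk, P, c, a, b, d]
  push_cast
  simp only [P, card_affineForm_solutions, Finset.sum_add_distrib]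
  have hsum : (∑ u, if a u = 0 ∧ b u = 0 ∧ d u = 0 then
        (if c u = 1 then (Fintype.card F : ℤ) ^ 3 else 0) - (Fintype.card F : ℤ) ^ 2 else 0) =
      ∑ y : F × F, ((if α * (1 - ε⁻¹ ^ 3) * y.1 ^ 3 + β * (1 - ε ^ 3) * y.2 ^ 3 = 1 then
        (Fintype.card F : ℤ) ^ 3 else 0) - (Fintype.card F : ℤ) ^ 2) := by
    rw [← Finset.sum_filter]
    symm
    refine Finset.sum_bij' (fun y _ => (y.1, -ε⁻¹ * y.1, y.2, -ε * y.2, 0))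
      (fun u _ => (u.1, u.2.2.1)) ?_ ?_ ?_ ?_ ?_
    · intro y _
      simp [a, b, d, hε]
    · simp
    · simp
    · rintro ⟨n, r, s, v, z⟩ h
      simp only [Finset.mem_filter, Finset.mem_univ, true_and, a, b, d] at h
      obtain ⟨ha, hb, hd⟩ := h
      have hz : z = 0 := by simpa [h3', hγ] using hd
      have hv : -ε * s = v := by linear_combination -ha
      have hr : -ε⁻¹ * n = r := by
        rw [eq_neg_of_add_eq_zero_left hb]
        field_simp
      simp only [hz, hv, hr]
    · rintro ⟨n, s⟩ _
      have : c (n, -ε⁻¹ * n, s, -ε * s, 0) =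
          α * (1 - ε⁻¹ ^ 3) * n ^ 3 + β * (1 - ε ^ 3) * s ^ 3 := by
        simp only [c]
        ring
      simp only [this]
  have hcurve : (Nat.card {(n, s) : F × F |
        α * (1 - ε⁻¹ ^ 3) * n ^ 3 + β * (1 - ε ^ 3) * s ^ 3 = 1} : ℤ) =
      ((Finset.univ.filter fun y : F × F =>
        α * (1 - ε⁻¹ ^ 3) * y.1 ^ 3 + β * (1 - ε ^ 3) * y.2 ^ 3 = 1).card : ℤ) := by
    rw [← Fintype.card_subtype, ← Nat.card_eq_fintype_card]
    rfl
  rw [hsum, hcurve, Finset.sum_sub_distrib, ← Finset.sum_filter]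
  simp only [Finset.sum_const, Finset.card_univ, Fintype.card_prod, nsmul_eq_mul]
  push_cast
  ring
end

section
/- Let F be a finite field with q elements, let α, β ∈ F and ε ∈ F with ε ≠ 0. Then the number of tuples (n,r,s,v,z,p,t,x) ∈ F^8 satisfying α(n³+r³) + β(s³+v³) + (1+ε)rvz + (εs+v)p + (n+εr)t = 1 equals q^7 − q^5 + q^3 · #{(n,s,z) ∈ F³ : α(1−ε^{−3})n³ + β(1−ε³)s³ + (1+ε)nsz = 1}. -/
/-- The number of points of the affine subset `a * p + b * t + c = 1` of the plane. -/
lemma card_affine_line {F : Type} [Field F] [Fintype F] [DecidableEq F] (a b c : F) :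
    (Nat.card {y : F × F // c + a * y.1 + b * y.2 = 1} : ℤ) =
      Fintype.card F - (if a = 0 ∧ b = 0 then (Fintype.card F : ℤ) else 0) +
        (if a = 0 ∧ b = 0 ∧ c = 1 then (Fintype.card F : ℤ) ^ 2 else 0) := by
  by_cases hb : b = 0
  · by_cases ha : a = 0
    · subst ha hb
      by_cases hc : c = 1
      · simp [hc, sq]
      · simp [hc]
    · have e : {y : F × F // c + a * y.1 + b * y.2 = 1} ≃ F :=
        { toFun := fun y => y.1.2
          invFun := fun t => ⟨(a⁻¹ * (1 - c), t), by subst hb; field_simp; ring⟩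
          left_inv := by
            rintro ⟨⟨p, t⟩, h⟩
            subst hb
            simp only [Subtype.mk.injEq, Prod.mk.injEq, and_true]
            field_simp
            linear_combination -h
          right_inv := fun _ => rfl }
      rw [Nat.card_congr e]
      simp [ha]
  · have e : {y : F × F // c + a * y.1 + b * y.2 = 1} ≃ F :=
      { toFun := fun y => y.1.1
        invFun := fun p => ⟨(p, b⁻¹ * (1 - c - a * p)), by field_simp; ring⟩
        left_inv := by
          rintro ⟨⟨p, t⟩, h⟩
          simp only [Subtype.mk.injEq, Prod.mk.injEq, true_and]
          field_simp
          linear_combination -h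
        right_inv := fun _ => rfl }
    rw [Nat.card_congr e]
    simp [hb]

/-- The number of points of a family of affine equations in two variables. -/
lemma card_affine_family {F ι : Type} [Field F] [Fintype F] [Fintype ι] (a b c : ι → F) :
    (Nat.card {y : ι × F × F // c y.1 + a y.1 * y.2.1 + b y.1 * y.2.2 = 1} : ℤ) =
      Fintype.card F * Fintype.card ι
        - Fintype.card F * Nat.card {i // a i = 0 ∧ b i = 0}
        + Fintype.card F ^ 2 * Nat.card {i // a i = 0 ∧ b i = 0 ∧ c i = 1} := by
  classical
  have e : {y : ι × F × F // c y.1 + a y.1 * y.2.1 + b y.1 * y.2.2 = 1} ≃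
      Σ i, {y : F × F // c i + a i * y.1 + b i * y.2 = 1} :=
    { toFun := fun y => ⟨y.1.1, y.1.2, y.2⟩
      invFun := fun y => ⟨(y.1, y.2.1), y.2.2⟩
      left_inv := fun _ => rfl
      right_inv := fun _ => rfl }
  rw [Nat.card_congr e, Nat.card_sigma]
  push_cast
  simp only [card_affine_line, Finset.sum_add_distrib, Finset.sum_sub_distrib,
    ← Finset.sum_filter, Finset.sum_const, nsmul_eq_mul, Finset.card_univ]
  simp only [Nat.card_eq_fintype_card, Fintype.card_subtype]
  ring

/-- over a finite field `F` with `q` elements, for `α, β ∈ F` and `ε ∈ F` with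
`ε ≠ 0`, the number of tuples `(n,r,s,v,z,p,t,x) ∈ F^8` with
`α(n³+r³) + β(s³+v³) + (1+ε)rvz + (εs+v)p + (n+εr)t = 1`
equals `q^7 − q^5 + q^3 · #{(n,s,z) : α(1−ε⁻³)n³ + β(1−ε³)s³ + (1+ε)nsz = 1}`. -/
theorem card_cell3_general_cubic_gamma_zero
    (F : Type) [Field F] [Fintype F] (α β ε : F) (hε : ε ≠ 0) :
    (Nat.card {(n, r, s, v, z, p, t, x) : F × F × F × F × F × F × F × F |
        α * (n ^ 3 + r ^ 3) + β * (s ^ 3 + v ^ 3) + (1 + ε) * r * v * z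
          + (ε * s + v) * p + (n + ε * r) * t = 1} : ℤ) =
      (Fintype.card F : ℤ) ^ 7 - (Fintype.card F : ℤ) ^ 5 +
        (Fintype.card F : ℤ) ^ 3 *
          (Nat.card {(n, s, z) : F × F × F |
            α * (1 - ε⁻¹ ^ 3) * n ^ 3 + β * (1 - ε ^ 3) * s ^ 3
              + (1 + ε) * n * s * z = 1} : ℤ) := by
  let a : F × F × F × F × F × F → F := fun (_, _, s, v, _, _) => ε * s + v
  let b : F × F × F × F × F × F → F := fun (n, r, _, _, _, _) => n + ε * r
  let c : F × F × F × F × F × F → F := fun (n, r, s, v, z, _) =>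
    α * (n ^ 3 + r ^ 3) + β * (s ^ 3 + v ^ 3) + (1 + ε) * r * v * z
  have total : {(n, r, s, v, z, p, t, x) : F × F × F × F × F × F × F × F |
        α * (n ^ 3 + r ^ 3) + β * (s ^ 3 + v ^ 3) + (1 + ε) * r * v * z
          + (ε * s + v) * p + (n + ε * r) * t = 1} ≃
      {y : (F × F × F × F × F × F) × F × F //
        c y.1 + a y.1 * y.2.1 + b y.1 * y.2.2 = 1} :=
    { toFun := fun ⟨(n, r, s, v, z, p, t, x), h⟩ => ⟨((n, r, s, v, z, x), p, t), h⟩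
      invFun := fun ⟨((n, r, s, v, z, x), p, t), h⟩ => ⟨(n, r, s, v, z, p, t, x), h⟩
      left_inv := fun _ => rfl
      right_inv := fun _ => rfl }
  have solve {n r s v : F} (ha : ε * s + v = 0) (hb : n + ε * r = 0) :
      r = -(ε⁻¹ * n) ∧ v = -(ε * s) := by
    refine ⟨?_, by linear_combination ha⟩
    field_simp
    linear_combination hb
  have degenerate : {i // a i = 0 ∧ b i = 0} ≃ F × F × F × F :=
    { toFun := fun ⟨(n, _, s, _, z, x), _⟩ => (n, s, z, x)
      invFun := fun (n, s, z, x) =>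
        ⟨(n, -(ε⁻¹ * n), s, -(ε * s), z, x), by simp [a, b, hε]⟩
      left_inv := by
        rintro ⟨⟨n, r, s, v, z, x⟩, ha, hb⟩
        obtain ⟨rfl, rfl⟩ := solve ha hb
        rfl
      right_inv := fun _ => rfl }
  have restrict (n s z x : F) : c (n, -(ε⁻¹ * n), s, -(ε * s), z, x) =
      α * (1 - ε⁻¹ ^ 3) * n ^ 3 + β * (1 - ε ^ 3) * s ^ 3 + (1 + ε) * n * s * z := by
    simp only [c]
    field_simp
    ring
  have residual : {i // a i = 0 ∧ b i = 0 ∧ c i = 1} ≃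
      {(n, s, z) : F × F × F | α * (1 - ε⁻¹ ^ 3) * n ^ 3 + β * (1 - ε ^ 3) * s ^ 3
        + (1 + ε) * n * s * z = 1} × F :=
    { toFun := fun ⟨(n, r, s, v, z, x), h⟩ => (⟨(n, s, z), by
          obtain ⟨ha, hb, hc⟩ := h
          obtain ⟨rfl, rfl⟩ := solve ha hb
          exact (restrict n s z x).symm.trans hc⟩, x)
      invFun := fun ⟨⟨(n, s, z), h⟩, x⟩ =>
        ⟨(n, -(ε⁻¹ * n), s, -(ε * s), z, x), by simp [a], by simp [b, hε],
          (restrict n s z x).trans h⟩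
      left_inv := by
        rintro ⟨⟨n, r, s, v, z, x⟩, ha, hb, hc⟩
        obtain ⟨rfl, rfl⟩ := solve ha hb
        rfl
      right_inv := fun _ => rfl }
  rw [Nat.card_congr total, card_affine_family, Nat.card_congr degenerate,
    Nat.card_congr residual]
  simp only [Nat.card_prod, Nat.card_eq_fintype_card (α := F), Fintype.card_prod]
  push_cast
  ring
end
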